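/- arXiv:1106.4474 — 6 statements merged into one kernel-verified Lean document; each statement's English description precedes it below -/
import Mathlib

section
/- Let V, W ⊆ Rad(A) be two n-dimensional k-subspaces each of which maps isomorphically onto Rad(A)/Rad²(A), and let ψ : V → W be the unique k-linear isomorphism such that ψ(v) − v ∈ Rad²(A) for all v ∈ V. Let M be a finite-dimensional A-module and 1 ≤ r ≤ n. Then: (a) the maximum of dim_k Rad_U(M) over all r-dimensional subspaces U ⊆ V equals the maximum of dim_k Rad_{U′}(M) over all r-dimensional subspaces U′ ⊆ W; (b) if an r-dimensional subspace U ⊆ V attains this maximum, then dim_k Rad_{ψ(U)}(M) = dim_k Rad_U(M); and (c) an r-dimensional subspace U ⊆ V attains the maximum if and only if ψ(U) attains the maximum over r-dimensional subspaces of W. -/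
open scoped TensorProduct

set_option synthInstance.maxHeartbeats 1000000
set_option maxHeartbeats 1000000

noncomputable section

def truncIdeal (k : Type*) [Field k] (n p : ℕ) : Ideal (MvPolynomial (Fin n) k) :=
  Ideal.span (Set.range fun i : Fin n => (MvPolynomial.X i : MvPolynomial (Fin n) k) ^ p)

abbrev TruncAlg (k : Type*) [Field k] (n p : ℕ) :=
  MvPolynomial (Fin n) k ⧸ truncIdeal k n p

def xGen (k : Type*) [Field k] (n p : ℕ) (i : Fin n) : TruncAlg k n p :=
  Ideal.Quotient.mk (truncIdeal k n p) (MvPolynomial.X i)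

def radIdeal (k : Type*) [Field k] (n p : ℕ) : Ideal (TruncAlg k n p) :=
  Ideal.span (Set.range (xGen k n p))

def xSpan (k : Type*) [Field k] (n p : ℕ) : Submodule k (TruncAlg k n p) :=
  Submodule.span k (Set.range (xGen k n p))

def IsFreeVia {C A : Type*} [CommRing C] [CommRing A] (α : C →+* A)
    (M : Type*) [AddCommGroup M] [Module A M] : Prop :=
  letI : Module C M := Module.compHom M α
  Module.Free C M

def smulLinear (k : Type*) {A : Type*} (M : Type*) [CommSemiring k] [Semiring A]
    [AddCommMonoid M] [Module k M] [Module A M] [SMulCommClass k A M] (a : A) :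
    M →ₗ[k] M where
  toFun m := a • m
  map_add' x y := smul_add a x y
  map_smul' c m := (smul_comm c a m).symm

def radPow (k A M : Type*) [CommSemiring k] [CommRing A] [AddCommMonoid M]
    [Module k M] [Module A M] [SMulCommClass k A M] (U : Set A) (j : ℕ) :
    Submodule k M :=
  ⨆ (u : Fin j → A) (_ : ∀ i, u i ∈ U), LinearMap.range (smulLinear k M (∏ i, u i))

def socPow (k A M : Type*) [CommSemiring k] [CommRing A] [AddCommMonoid M]
    [Module k M] [Module A M] [SMulCommClass k A M] (U : Set A) (j : ℕ) :
    Submodule k M :=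
  ⨅ (u : Fin j → A) (_ : ∀ i, u i ∈ U), LinearMap.ker (smulLinear k M (∏ i, u i))

section MaximalRadicals

open Submodule LinearMap

theorem rank_quotient_eq_add {k C : Type*} [Field k] [AddCommGroup C] [Module k C]
    (K F : Submodule k C) :
    Module.rank k (C ⧸ F) =
      Module.rank k (C ⧸ (K ⊔ F)) + Module.rank k (K ⧸ F.comap K.subtype) := by
  rw [sup_comm, ← (quotientQuotientEquivQuotientSup F K).rank_eq,
    ← rank_quotient_add_rank (K.map F.mkQ)]
  congr 1
  have h : ker (F.mkQ.comp K.subtype) = F.comap K.subtype := by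
    rw [ker_comp, ker_mkQ]
  rw [← h, (quotKerEquivRange (F.mkQ.comp K.subtype)).rank_eq, range_comp, range_subtype]

theorem rank_quotient_ker_sup_range {k C : Type*} [Field k] [AddCommGroup C] [Module k C]
    (a f : Module.End k C) (f' : Module.End k (range a))
    (h : ∀ x, f' (a.rangeRestrict x) = a.rangeRestrict (f x)) :
    Module.rank k (C ⧸ (ker a ⊔ range f)) = Module.rank k (range a ⧸ range f') := by
  have hk : ker ((range f').mkQ.comp a.rangeRestrict) = ker a ⊔ range f := by
    ext x
    rw [mem_ker, comp_apply, mkQ_apply, Quotient.mk_eq_zero, mem_range, mem_sup]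
    constructor
    · rintro ⟨y, hy⟩
      obtain ⟨z, rfl⟩ := a.surjective_rangeRestrict y
      rw [h] at hy
      refine ⟨x - f z, ?_, f z, ⟨z, rfl⟩, by abel⟩
      have := congrArg Subtype.val hy
      simp only [codRestrict_apply, LinearMap.rangeRestrict] at this
      simp [this]
    · rintro ⟨y, hy, _, ⟨z, rfl⟩, rfl⟩
      refine ⟨a.rangeRestrict z, ?_⟩
      have hy' : a.rangeRestrict y = 0 := Subtype.ext hy
      rw [h, map_add, hy', zero_add]
  rw [← hk]
  exact (quotKerEquivOfSurjective ((range f').mkQ.comp a.rangeRestrict)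
    ((mkQ_surjective (range f')).comp a.surjective_rangeRestrict)).rank_eq

theorem rank_quotient_range_sub_le {k : Type*} [Field k] (e : ℕ) :
    ∀ {C : Type*} [AddCommGroup C] [Module k C] (T a : Module.End k C),
      Commute T a → Function.Injective T → a ^ e = 0 →
      Module.rank k (C ⧸ range (T - a)) ≤ Module.rank k (C ⧸ range T) := by
  induction e with
  | zero =>
    intro C _ _ T a _ _ h
    have : Subsingleton C := ⟨fun x y => by
      have := fun z => LinearMap.congr_fun h z
      simp at this
      rw [this x, this y]⟩
    simp
  | succ e ih =>
    intro C _ _ T a hc hT h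
    have hc' : ∀ x, T (a x) = a (T x) := fun x => LinearMap.congr_fun hc.eq x
    have hTr : ∀ x ∈ range a, T x ∈ range a := by
      rintro _ ⟨y, rfl⟩; exact ⟨T y, (hc' y).symm⟩
    have har : ∀ x ∈ range a, a x ∈ range a := fun x _ => ⟨x, rfl⟩
    have key := ih (T.restrict hTr) (a.restrict har)
      (LinearMap.ext fun x => Subtype.ext (hc' x))
      (fun x y hxy => Subtype.ext (hT (congrArg Subtype.val hxy)))
      (by
        ext ⟨_, y, rfl⟩
        rw [Module.End.pow_restrict]
        simpa [pow_succ] using LinearMap.congr_fun h y)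
    rw [rank_quotient_eq_add (ker a) (range (T - a)), rank_quotient_eq_add (ker a) (range T),
      rank_quotient_ker_sup_range a (T - a) (T.restrict hTr - a.restrict har)
        (fun x => Subtype.ext (by simp [LinearMap.rangeRestrict, hc'])),
      rank_quotient_ker_sup_range a T (T.restrict hTr)
        (fun x => Subtype.ext (by simp [LinearMap.rangeRestrict, hc']))]
    refine add_le_add key ?_
    have hle : (range T).comap (ker a).subtype ≤ (range (T - a)).comap (ker a).subtype := by
      rintro ⟨x, hx⟩ ⟨y, rfl⟩
      have hy : a y = 0 := hT (by rw [hc', map_zero]; exact hx)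
      exact ⟨y, by simp [hy]⟩
    exact rank_le_of_surjective (Submodule.factor hle) (Submodule.factor_surjective hle)

section RadicalFamily

open Polynomial

variable {k A M E : Type*} [Field k] [CommRing A] [Algebra k A] [AddCommGroup M]
  [Module A M] [AddCommGroup E] [Module k E]

variable (M) in
/-- The `A`-submodule of `M` generated by the products `θ x • m` with `x ∈ U`. -/
def radSub (θ : E →ₗ[k] A) (U : Submodule k E) : Submodule A M :=
  span A {y | ∃ x ∈ U, ∃ m : M, y = θ x • m}

variable (M) in
/-- The analogue of `radSub` in `M[X]` for the line of maps `θ + X δ`. -/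
def polyRad (θ δ : E →ₗ[k] A) (U : Submodule k E) : Submodule A[X] (PolynomialModule A M) :=
  span A[X] {F | ∃ x ∈ U, ∃ f : PolynomialModule A M, F = (C (θ x) + X * C (δ x)) • f}

theorem eval_mem_radSub {θ δ : E →ₗ[k] A} {U : Submodule k E} (s : A) {F : PolynomialModule A M}
    (hF : F ∈ polyRad M θ δ U) : PolynomialModule.eval s F ∈ radSub M (θ + s • δ) U := by
  induction hF using span_induction with
  | mem F h =>
    obtain ⟨x, hx, f, rfl⟩ := h
    exact subset_span ⟨x, hx, PolynomialModule.eval s f, by simp [mul_comm s]⟩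
  | zero => simp
  | add F G _ _ hF hG => rw [map_add]; exact add_mem hF hG
  | smul g F _ hF => rw [PolynomialModule.eval_smul]; exact Submodule.smul_mem _ _ hF

theorem exists_mem_polyRad_eval_zero {θ : E →ₗ[k] A} (δ : E →ₗ[k] A) {U : Submodule k E} {y : M}
    (hy : y ∈ radSub M θ U) : ∃ F ∈ polyRad M θ δ U, PolynomialModule.eval (0 : A) F = y := by
  induction hy using span_induction with
  | mem y h =>
    obtain ⟨x, hx, m, rfl⟩ := h
    exact ⟨_, subset_span ⟨x, hx, PolynomialModule.single A 0 m, rfl⟩, by simp⟩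
  | zero => exact ⟨0, zero_mem _, map_zero _⟩
  | add y z _ _ hy hz =>
    obtain ⟨F, hF, rfl⟩ := hy
    obtain ⟨G, hG, rfl⟩ := hz
    exact ⟨F + G, add_mem hF hG, map_add _ _ _⟩
  | smul a y _ hy =>
    obtain ⟨F, hF, rfl⟩ := hy
    exact ⟨C a • F, Submodule.smul_mem _ _ hF, by simp⟩

/-- The saturation of an `A[X]`-submodule of `M[X]` with respect to the nonzero polynomials
over `k`. -/
def polySat (k : Type*) {A M : Type*} [Field k] [CommRing A] [Algebra k A] [AddCommGroup M]
    [Module A M] (N : Submodule A[X] (PolynomialModule A M)) :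
    Submodule A[X] (PolynomialModule A M) where
  carrier := {f | ∃ g : k[X], g ≠ 0 ∧ g.map (algebraMap k A) • f ∈ N}
  zero_mem' := ⟨1, one_ne_zero, by simp⟩
  add_mem' := by
    rintro f₁ f₂ ⟨g₁, h₁, m₁⟩ ⟨g₂, h₂, m₂⟩
    refine ⟨g₁ * g₂, mul_ne_zero h₁ h₂, ?_⟩
    rw [Polynomial.map_mul, smul_add]
    refine add_mem ?_ ?_
    · rw [mul_comm, mul_smul]; exact N.smul_mem _ m₁
    · rw [mul_smul]; exact N.smul_mem _ m₂
  smul_mem' := by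
    rintro c f ⟨g, h, m⟩
    exact ⟨g, h, by rw [smul_comm]; exact N.smul_mem _ m⟩

theorem mem_polySat_of_X_smul {N : Submodule A[X] (PolynomialModule A M)}
    {f : PolynomialModule A M} (hf : (X : A[X]) • f ∈ polySat k N) : f ∈ polySat k N := by
  obtain ⟨g, hg, h⟩ := hf
  refine ⟨g * X, mul_ne_zero hg X_ne_zero, ?_⟩
  rwa [Polynomial.map_mul, Polynomial.map_X, mul_smul]

theorem radSub_comp (θ : E →ₗ[k] A) (g : E →ₗ[k] E) (U : Submodule k E) :
    radSub M (θ.comp g) U = radSub M θ (U.map g) := by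
  simp [radSub]

theorem exists_sub_eval_eq_X_smul (a : A) (f : PolynomialModule A M) :
    ∃ g : PolynomialModule A M,
      f - PolynomialModule.single A 0 (PolynomialModule.eval a f) = ((X : A[X]) - C a) • g := by
  induction f using PolynomialModule.induction_linear with
  | zero => exact ⟨0, by simp⟩
  | add f g hf hg =>
    obtain ⟨f', hf⟩ := hf
    obtain ⟨g', hg⟩ := hg
    refine ⟨f' + g', ?_⟩
    rw [smul_add, ← hf, ← hg, map_add, PolynomialModule.single_add]
    abel
  | single n m =>
    obtain ⟨q, hq⟩ := sub_dvd_pow_sub_pow (X : A[X]) (C a) n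
    refine ⟨q • PolynomialModule.single A 0 m, ?_⟩
    rw [← mul_smul, ← hq, sub_smul, PolynomialModule.eval_single, ← C_pow,
      ← monomial_zero_left, X_pow_eq_monomial, PolynomialModule.monomial_smul_single,
      PolynomialModule.monomial_smul_single]
    simp

theorem eval_polySat_le {θ δ : E →ₗ[k] A} {U : Submodule k E} {a : A} (ha : IsNilpotent a)
    (h0 : ∀ f ∈ polySat k (polyRad M θ δ U), PolynomialModule.eval (0 : A) f ∈ radSub M θ U)
    {f : PolynomialModule A M} (hf : f ∈ polySat k (polyRad M θ δ U)) :
    PolynomialModule.eval a f ∈ radSub M (θ + a • δ) U := by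
  have key : ∀ e : ℕ, ∀ f ∈ polySat k (polyRad M θ δ U), ∃ m : M,
      PolynomialModule.eval a f - a ^ e • m ∈ radSub M (θ + a • δ) U := by
    intro e
    induction e with
    | zero => exact fun f _ => ⟨PolynomialModule.eval a f, by simp⟩
    | succ e ih =>
      intro f hf
      obtain ⟨F, hF, hF0⟩ := exists_mem_polyRad_eval_zero δ (h0 f hf)
      obtain ⟨g, hg⟩ := exists_sub_eval_eq_X_smul (0 : A) (f - F)
      rw [map_sub, hF0, sub_self, PolynomialModule.single_zero, sub_zero, C_0, sub_zero] at hg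
      have hgS : g ∈ polySat k (polyRad M θ δ U) := mem_polySat_of_X_smul (by
        rw [← hg]
        exact sub_mem hf ⟨1, one_ne_zero, by simpa using hF⟩)
      obtain ⟨m, hm⟩ := ih g hgS
      refine ⟨m, ?_⟩
      have hfe : PolynomialModule.eval a f =
          PolynomialModule.eval a F + a • PolynomialModule.eval a g := by
        rw [eq_add_of_sub_eq' hg, map_add, PolynomialModule.eval_smul, eval_X]
      rw [hfe, pow_succ', mul_smul, add_sub_assoc, ← smul_sub]
      exact add_mem (eval_mem_radSub a hF) (Submodule.smul_mem _ _ hm)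
  obtain ⟨e, he⟩ := ha
  obtain ⟨m, hm⟩ := key e f hf
  simpa [he] using hm

variable [Module k M] [IsScalarTower k A M]

theorem exists_polynomial_eval (π : M →ₗ[k] k) (f : PolynomialModule A M) :
    ∃ q : k[X], ∀ t : k, q.eval t = π (PolynomialModule.eval (algebraMap k A t) f) := by
  induction f using PolynomialModule.induction_linear with
  | zero => exact ⟨0, by simp⟩
  | add f g hf hg =>
    obtain ⟨p, hp⟩ := hf
    obtain ⟨q, hq⟩ := hg
    exact ⟨p + q, fun t => by simp [hp, hq]⟩
  | single n m =>
    refine ⟨C (π m) * X ^ n, fun t => ?_⟩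
    rw [PolynomialModule.eval_single, ← map_pow, algebraMap_smul, map_smul]
    rw [eval_mul, eval_C, eval_pow, eval_X, smul_eq_mul, mul_comm]

/-- Values at a generic point of `k` of finitely many elements of `M[X]` are linearly independent
as soon as their values at zero are. -/
theorem exists_polynomial_linearIndependent [FiniteDimensional k M] {ι : Type*} [Fintype ι]
    [DecidableEq ι] (f : ι → PolynomialModule A M)
    (hf : LinearIndependent k fun i => PolynomialModule.eval (0 : A) (f i)) :
    ∃ D : k[X], D ≠ 0 ∧ ∀ t : k, D.eval t ≠ 0 →
      LinearIndependent k fun i => PolynomialModule.eval (algebraMap k A t) (f i) := by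
  obtain ⟨π, hπ⟩ := LinearMap.exists_leftInverse_of_injective
    (Fintype.linearCombination k fun i => PolynomialModule.eval (0 : A) (f i))
    (ker_eq_bot.2 (linearIndependent_iff_injective_fintypeLinearCombination.1 hf))
  choose q hq using fun i j => exists_polynomial_eval ((LinearMap.proj j).comp π) (f i)
  have hev : ∀ t, (Matrix.of q).det.eval t =
      (Matrix.of fun i j => π (PolynomialModule.eval (algebraMap k A t) (f i)) j).det := by
    intro t
    rw [← coe_evalRingHom, RingHom.map_det]
    congr 1
    ext i j
    simp [hq]
  refine ⟨(Matrix.of q).det, ?_, fun t ht => ?_⟩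
  · intro h0
    have h1 := hev 0
    have : (Matrix.of fun i j => π (PolynomialModule.eval (algebraMap k A 0) (f i)) j)
        = (1 : Matrix ι ι k) := by
      ext i j
      have := congrFun (LinearMap.congr_fun hπ (Pi.single i 1)) j
      rw [comp_apply, Fintype.linearCombination_apply_single] at this
      simpa [Matrix.one_apply, Pi.single_apply, eq_comm] using this
    rw [this, h0] at h1
    simp at h1
  · rw [hev] at ht
    exact LinearIndependent.of_comp π (Matrix.linearIndependent_rows_of_det_ne_zero ht)

theorem eval_zero_polySat_le [Infinite k] [FiniteDimensional k M] {θ δ : E →ₗ[k] A}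
    {U : Submodule k E} {q : k[X]} (hq : q ≠ 0)
    (hmax : ∀ t : k, q.eval t ≠ 0 → Module.finrank k (radSub M (θ + algebraMap k A t • δ) U) ≤
      Module.finrank k (radSub M θ U))
    {f : PolynomialModule A M} (hf : f ∈ polySat k (polyRad M θ δ U)) :
    PolynomialModule.eval (0 : A) f ∈ radSub M θ U := by
  let S : Submodule k M := ((polySat k (polyRad M θ δ U)).restrictScalars A |>.map
    (PolynomialModule.eval (0 : A))).restrictScalars k
  let L : Submodule k M := (radSub M θ U).restrictScalars k
  have hLS : L ≤ S := by
    intro y hy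
    obtain ⟨F, hF, rfl⟩ := exists_mem_polyRad_eval_zero δ hy
    exact ⟨F, ⟨1, one_ne_zero, by simpa using hF⟩, rfl⟩
  let b := Module.finBasis k S
  choose F hFS hFb using fun i => (b i).2
  choose g hg0 hg using hFS
  obtain ⟨D, hD0, hD⟩ := exists_polynomial_linearIndependent (k := k) F (by
    rw [funext hFb]
    exact b.linearIndependent.map' S.subtype (ker_subtype S))
  obtain ⟨t, ht⟩ : ∃ t : k, (q * D * ∏ i, g i).eval t ≠ 0 := by
    by_contra! h
    exact mul_ne_zero (mul_ne_zero hq hD0) (Finset.prod_ne_zero_iff.2 fun i _ => hg0 i)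
      (Polynomial.funext fun r => by rw [h r, eval_zero])
  rw [eval_mul, eval_mul, eval_prod] at ht
  have hq' := left_ne_zero_of_mul (left_ne_zero_of_mul ht)
  have hD' := right_ne_zero_of_mul (left_ne_zero_of_mul ht)
  have hg' := Finset.prod_ne_zero_iff.1 (right_ne_zero_of_mul ht)
  have hmem : ∀ i, PolynomialModule.eval (algebraMap k A t) (F i) ∈
      (radSub M (θ + algebraMap k A t • δ) U).restrictScalars k := by
    intro i
    have := eval_mem_radSub (algebraMap k A t) (hg i)
    rw [PolynomialModule.eval_smul, eval_map_algebraMap, aeval_algebraMap_apply,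
      coe_aeval_eq_eval, algebraMap_smul A (eval t (g i))] at this
    exact ((Submodule.smul_mem_iff ((radSub M (θ + algebraMap k A t • δ) U).restrictScalars k)
      (hg' i (Finset.mem_univ i))).1 this)
  have hle : Module.finrank k S ≤ Module.finrank k L := by
    refine le_trans ?_ (hmax t hq')
    have hli : LinearIndependent k fun i => (⟨_, hmem i⟩ :
        (radSub M (θ + algebraMap k A t • δ) U).restrictScalars k) :=
      LinearIndependent.of_comp (Submodule.subtype _) (hD t hD')
    exact (Fintype.card_fin _).ge.trans hli.fintype_card_le_finrank
  have := Submodule.eq_of_le_of_finrank_le hLS hle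
  change _ ∈ L
  rw [this]
  exact ⟨f, hf, rfl⟩

theorem finrank_radSub_le [Infinite k] [FiniteDimensional k M] {θ δ : E →ₗ[k] A}
    {U : Submodule k E} {q : k[X]} (hq : q ≠ 0)
    (hmax : ∀ t : k, q.eval t ≠ 0 → Module.finrank k (radSub M (θ + algebraMap k A t • δ) U) ≤
      Module.finrank k (radSub M θ U)) {a : A} (ha : IsNilpotent a) :
    Module.finrank k (radSub M θ U) ≤ Module.finrank k (radSub M (θ + a • δ) U) := by
  have h0 := fun f => eval_zero_polySat_le hq hmax (f := f)
  let S := polySat k (polyRad M θ δ U)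
  let T : Module.End k (PolynomialModule A M ⧸ S) := Module.toModuleEnd k _ (X : A[X])
  let α : Module.End k (PolynomialModule A M ⧸ S) := Module.toModuleEnd k _ (C a : A[X])
  have hcomm : Commute T α := (Commute.all (X : A[X]) (C a)).map (Module.toModuleEnd k _)
  have hT : Function.Injective T := by
    rw [injective_iff_map_eq_zero]
    intro x hx
    obtain ⟨f, rfl⟩ := S.mkQ_surjective x
    have hx' : S.mkQ ((X : A[X]) • f) = 0 := hx
    rw [mkQ_apply, Quotient.mk_eq_zero] at hx'
    rw [mkQ_apply, Quotient.mk_eq_zero]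
    exact mem_polySat_of_X_smul hx'
  obtain ⟨e, he⟩ := ha
  have hα : α ^ e = 0 := by
    rw [← map_pow, ← C_pow, he, C_0, map_zero]
  let L := (radSub M θ U).restrictScalars k
  let L' := (radSub M (θ + a • δ) U).restrictScalars k
  have h1 : Module.rank k ((PolynomialModule A M ⧸ S) ⧸ range T) ≤ Module.rank k (M ⧸ L) := by
    let φ : M →ₗ[k] (PolynomialModule A M ⧸ S) ⧸ range T :=
      (range T).mkQ.comp (((S.mkQ.restrictScalars k)).comp
        ((PolynomialModule.lsingle A 0).restrictScalars k))
    have hX : ∀ g : PolynomialModule A M, (range T).mkQ (S.mkQ ((X : A[X]) • g)) = 0 := by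
      intro g
      rw [mkQ_apply, Quotient.mk_eq_zero]
      exact ⟨S.mkQ g, rfl⟩
    have hφ : ∀ f : PolynomialModule A M,
        φ (PolynomialModule.eval (0 : A) f) = (range T).mkQ (S.mkQ f) := by
      intro f
      obtain ⟨g, hg⟩ := exists_sub_eval_eq_X_smul (0 : A) f
      rw [C_0, sub_zero] at hg
      have := hX g
      rw [← hg, map_sub, map_sub, sub_eq_zero] at this
      exact this.symm
    have hL : L ≤ ker φ := by
      intro y hy
      obtain ⟨F, hF, rfl⟩ := exists_mem_polyRad_eval_zero δ hy
      have : S.mkQ F = 0 := by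
        rw [mkQ_apply, Quotient.mk_eq_zero]
        exact ⟨1, one_ne_zero, by simpa using hF⟩
      rw [mem_ker, hφ, this, map_zero]
    refine rank_le_of_surjective (L.liftQ φ hL) ?_
    intro z
    obtain ⟨x, rfl⟩ := (range T).mkQ_surjective z
    obtain ⟨f, rfl⟩ := S.mkQ_surjective x
    exact ⟨L.mkQ (PolynomialModule.eval (0 : A) f), hφ f⟩
  have h2 : Module.rank k (M ⧸ L') ≤
      Module.rank k ((PolynomialModule A M ⧸ S) ⧸ range (T - α)) := by
    let ev : PolynomialModule A M →ₗ[k] M ⧸ L' :=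
      L'.mkQ.comp ((PolynomialModule.eval a).restrictScalars k)
    have hev : S.restrictScalars k ≤ ker ev := by
      intro f hf
      rw [mem_ker, comp_apply, mkQ_apply, Quotient.mk_eq_zero]
      exact eval_polySat_le ⟨e, he⟩ h0 hf
    let ev₁ : (PolynomialModule A M ⧸ S) →ₗ[k] M ⧸ L' :=
      ((S.restrictScalars k).liftQ ev hev).comp
        (Submodule.Quotient.restrictScalarsEquiv k S).symm.toLinearMap
    have hev₁ : ∀ f, ev₁ (S.mkQ f) = ev f := fun _ => rfl
    have hker : range (T - α) ≤ ker ev₁ := by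
      rintro _ ⟨x, rfl⟩
      obtain ⟨f, rfl⟩ := S.mkQ_surjective x
      have : (T - α) (S.mkQ f) = S.mkQ (((X : A[X]) - C a) • f) := by
        rw [sub_smul, map_sub]
        rfl
      rw [this, mem_ker, hev₁]
      simp [ev]
    refine rank_le_of_surjective ((range (T - α)).liftQ ev₁ hker) ?_
    intro z
    obtain ⟨m, rfl⟩ := L'.mkQ_surjective z
    exact ⟨(range (T - α)).mkQ (S.mkQ (PolynomialModule.single A 0 m)), by
      rw [mkQ_apply, liftQ_apply, hev₁]
      simp [ev]⟩
  have h3 := (h2.trans (rank_quotient_range_sub_le e T α hcomm hT hα)).trans h1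
  have h4 : Module.finrank k (M ⧸ L') ≤ Module.finrank k (M ⧸ L) :=
    Cardinal.toNat_le_toNat h3 (Module.rank_lt_aleph0 k _)
  have h5 := L.finrank_quotient_add_finrank
  have h6 := L'.finrank_quotient_add_finrank
  change Module.finrank k L ≤ Module.finrank k L'
  omega

variable (M) in
/-- `U` has dimension `r` and maximizes the dimension of `radSub M θ U` among such subspaces. -/
def IsMaxRad (r : ℕ) (θ : E →ₗ[k] A) (U : Submodule k E) : Prop :=
  Module.finrank k U = r ∧ ∀ U₀ : Submodule k E, Module.finrank k U₀ = r →
    Module.finrank k (radSub M θ U₀) ≤ Module.finrank k (radSub M θ U)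

variable (M) in
/-- `θ` and `θ'` have the same maximizing subspaces, with the same dimensions of radicals. -/
def RadEquiv (r : ℕ) (θ θ' : E →ₗ[k] A) : Prop :=
  ∀ (U : Submodule k E) (d : ℕ), (IsMaxRad M r θ U ∧ Module.finrank k (radSub M θ U) = d) ↔
    (IsMaxRad M r θ' U ∧ Module.finrank k (radSub M θ' U) = d)

theorem exists_isMaxRad [FiniteDimensional k M] {r : ℕ} (θ : E →ₗ[k] A) {U : Submodule k E}
    (hU : Module.finrank k U = r) : ∃ U', IsMaxRad M r θ U' := by
  let s : Set ℕ := {d | ∃ U : Submodule k E, Module.finrank k U = r ∧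
    d = Module.finrank k (radSub M θ U)}
  have hs : BddAbove s := by
    refine ⟨Module.finrank k M, ?_⟩
    rintro _ ⟨U, _, rfl⟩
    exact ((radSub M θ U).restrictScalars k).finrank_le
  obtain ⟨U', hU', h⟩ := Nat.sSup_mem (s := s) ⟨_, U, hU, rfl⟩ hs
  exact ⟨U', hU', fun U₀ h₀ => h ▸ le_csSup hs ⟨U₀, h₀, rfl⟩⟩

theorem radEquiv_of_le [FiniteDimensional k M] {r : ℕ} {θ θ' : E →ₗ[k] A}
    (h : ∀ U, IsMaxRad M r θ U →
      Module.finrank k (radSub M θ U) ≤ Module.finrank k (radSub M θ' U))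
    (h' : ∀ U, IsMaxRad M r θ' U →
      Module.finrank k (radSub M θ' U) ≤ Module.finrank k (radSub M θ U)) :
    RadEquiv M r θ θ' := by
  have aux : ∀ {θ θ' : E →ₗ[k] A}, (∀ U, IsMaxRad M r θ U →
      Module.finrank k (radSub M θ U) ≤ Module.finrank k (radSub M θ' U)) →
      (∀ U, IsMaxRad M r θ' U →
      Module.finrank k (radSub M θ' U) ≤ Module.finrank k (radSub M θ U)) → ∀ U,
      IsMaxRad M r θ U → IsMaxRad M r θ' U ∧
        Module.finrank k (radSub M θ' U) = Module.finrank k (radSub M θ U) := by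
    intro θ θ' h h' U hU
    obtain ⟨U', hU'⟩ := exists_isMaxRad (M := M) θ' hU.1
    have h₁ := h U hU
    have h₂ := h' U' hU'
    have h₃ := hU.2 U' hU'.1
    exact ⟨⟨hU.1, fun U₀ h₀ => (hU'.2 U₀ h₀).trans (by omega)⟩,
      le_antisymm ((hU'.2 U hU.1).trans (h₂.trans h₃)) h₁⟩
  intro U d
  constructor
  · rintro ⟨hU, rfl⟩
    exact aux h h' U hU
  · rintro ⟨hU, rfl⟩
    exact aux h' h U hU

theorem finrank_radSub_le_of_isMaxRad [Infinite k] [FiniteDimensional k M] {r : ℕ}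
    {θ : E →ₗ[k] A} {U : Submodule k E} (hU : IsMaxRad M r θ U) {a : A} (ha : IsNilpotent a)
    (l : E →ₗ[k] k) (e : E) : Module.finrank k (radSub M θ U) ≤
      Module.finrank k (radSub M (θ + l.smulRight (a * θ e)) U) := by
  have hq : (1 + X * C (l e) : k[X]) ≠ 0 := by
    intro h
    simpa using congrArg (Polynomial.eval 0) h
  have hδ : l.smulRight (a * θ e) = a • l.smulRight (θ e) := by
    ext x
    simp
  rw [hδ]
  refine finrank_radSub_le hq (fun t ht => ?_) ha
  rw [eval_add, eval_one, eval_mul, eval_X, eval_C] at ht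
  have hg : θ + algebraMap k A t • l.smulRight (θ e) =
      θ.comp (LinearMap.id + l.smulRight (t • e)) := by
    ext x
    simp [Algebra.smul_def]
    ring
  have hinj : Function.Injective (LinearMap.id + l.smulRight (t • e) : E →ₗ[k] E) := by
    rw [injective_iff_map_eq_zero]
    intro x hx
    have hx' : x + l x • t • e = 0 := hx
    have hl : l x * (1 + t * l e) = 0 := by
      have := congrArg l hx'
      simp at this
      linear_combination this
    rw [(mul_eq_zero.1 hl).resolve_right ht, zero_smul, add_zero] at hx'
    exact hx'
  rw [hg, radSub_comp]
  exact hU.2 _ (((Submodule.equivMapOfInjective _ hinj U).finrank_eq).symm.trans hU.1)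

theorem radEquiv_add_smulRight_mul [Infinite k] [FiniteDimensional k M] (r : ℕ)
    (θ : E →ₗ[k] A) {a : A} (ha : IsNilpotent a) (l : E →ₗ[k] k) (e : E) :
    RadEquiv M r θ (θ + l.smulRight (a * θ e)) := by
  refine radEquiv_of_le (fun U hU => finrank_radSub_le_of_isMaxRad hU ha l e) fun U hU => ?_
  have hu : IsUnit (1 + l e • a) := (ha.smul (l e)).isUnit_one_add
  obtain ⟨w, hw⟩ := hu.exists_left_inv
  have := finrank_radSub_le_of_isMaxRad hU (a := -(a * w))
    ((Commute.all a w).isNilpotent_mul_right ha).neg l e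
  have heq : -(a * w) * (θ + l.smulRight (a * θ e)) e = -(a * θ e) := by
    simp only [LinearMap.add_apply, smulRight_apply, Algebra.smul_def] at hw ⊢
    linear_combination (-(a * θ e)) * hw
  rw [heq] at this
  have hθ : θ + l.smulRight (a * θ e) + l.smulRight (-(a * θ e)) = θ := by
    ext x
    simp
  rwa [hθ] at this

theorem radEquiv_add_smulRight [Infinite k] [FiniteDimensional k M] {J : Ideal A} (r : ℕ)
    (hJ : IsNilpotent J) (j : ℕ) : ∀ m, 2 ≤ m → (J ^ (m + j) = ⊥) → ∀ q ∈ J ^ m,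
      ∀ θ : E →ₗ[k] A, (∀ b ∈ J, ∃ e, b - θ e ∈ J ^ 2) → ∀ l : E →ₗ[k] k,
        RadEquiv M r θ (θ + l.smulRight q) := by
  obtain ⟨N, hN⟩ := hJ
  have zero : ∀ (θ : E →ₗ[k] A) (l : E →ₗ[k] k), RadEquiv M r θ (θ + l.smulRight (0 : A)) := by
    intro θ l
    have : θ + l.smulRight (0 : A) = θ := by ext; simp
    rw [this]
    exact fun _ _ => Iff.rfl
  have good : ∀ {θ : E →ₗ[k] A}, (∀ b ∈ J, ∃ e, b - θ e ∈ J ^ 2) → ∀ q ∈ J ^ 2,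
      ∀ l : E →ₗ[k] k, ∀ b ∈ J, ∃ e, b - (θ + l.smulRight q) e ∈ J ^ 2 := by
    intro θ hθ q hq l b hb
    obtain ⟨e, he⟩ := hθ b hb
    refine ⟨e, ?_⟩
    rw [LinearMap.add_apply, ← sub_sub]
    exact sub_mem he (Submodule.smul_of_tower_mem _ _ hq)
  have trans_add : ∀ {θ : E →ₗ[k] A} {q q' : A} {l : E →ₗ[k] k}, RadEquiv M r θ (θ + l.smulRight q) →
      RadEquiv M r (θ + l.smulRight q) (θ + l.smulRight q + l.smulRight q') →
      RadEquiv M r θ (θ + l.smulRight (q + q')) := by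
    intro θ q q' l h h'
    have : θ + l.smulRight (q + q') = θ + l.smulRight q + l.smulRight q' := by
      ext; simp [add_assoc]
    rw [this]
    exact fun U d => (h U d).trans (h' U d)
  induction j with
  | zero =>
    intro m _ hm q hq θ _ l
    rw [add_zero] at hm
    rw [hm, Submodule.mem_bot] at hq
    rw [hq]
    exact zero θ l
  | succ j ih =>
    intro m hm hmj q hq
    obtain ⟨m, rfl⟩ := Nat.exists_eq_add_of_le' (show 1 ≤ m by omega)
    have hle : J ^ (m + 1) ≤ J ^ 2 := Ideal.pow_le_pow_right hm
    rw [pow_succ] at hq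
    have key : q ∈ J ^ 2 ∧ ∀ θ : E →ₗ[k] A, (∀ b ∈ J, ∃ e, b - θ e ∈ J ^ 2) →
        ∀ l : E →ₗ[k] k, RadEquiv M r θ (θ + l.smulRight q) := by
      induction hq using Submodule.mul_induction_on' with
      | mem_mul_mem a ha b hb =>
        refine ⟨hle (pow_succ J m ▸ Ideal.mul_mem_mul ha hb), fun θ hθ l => ?_⟩
        obtain ⟨e, he⟩ := hθ b hb
        have hab : a * b = a * θ e + a * (b - θ e) := by ring
        have h3 : a * (b - θ e) ∈ J ^ (m + 1 + 1) := by
          rw [show m + 1 + 1 = m + 2 by ring, pow_add]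
          exact Ideal.mul_mem_mul ha he
        have h2 : a * θ e ∈ J ^ 2 := by
          rw [eq_sub_of_add_eq hab.symm]
          exact sub_mem (hle (pow_succ J m ▸ Ideal.mul_mem_mul ha hb))
            (hle (Ideal.pow_le_pow_right (Nat.le_succ _) h3))
        have han : IsNilpotent a := by
          refine ⟨N, ?_⟩
          have := Ideal.pow_mem_pow (Ideal.pow_le_self (by omega) ha) N
          rwa [hN] at this
        rw [hab]
        exact trans_add (radEquiv_add_smulRight_mul r θ han l e)
          (ih (m + 1 + 1) (by omega) (by rw [← hmj]; congr 1; ring) _ h3 _ (good hθ _ h2 l) l)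
      | add x _ y _ hx hy =>
        exact ⟨add_mem hx.1 hy.1, fun θ hθ l =>
          trans_add (hx.2 θ hθ l) (hy.2 _ (good hθ _ hx.1 l) l)⟩
    exact key.2

/-- Altering `θ` by a map with values in `J ^ 2` does not change the maximizing subspaces. -/
theorem radEquiv_add [Infinite k] [FiniteDimensional k M] [FiniteDimensional k E] {J : Ideal A}
    (r : ℕ) (hJ : IsNilpotent J) {θ : E →ₗ[k] A} (hθ : ∀ b ∈ J, ∃ e, b - θ e ∈ J ^ 2)
    {φ : E →ₗ[k] A} (hφ : ∀ x, φ x ∈ J ^ 2) : RadEquiv M r θ (θ + φ) := by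
  obtain ⟨N, hN⟩ := id hJ
  have hN' : J ^ (2 + N) = ⊥ := by rw [pow_add, hN, mul_zero]; rfl
  let b := Module.finBasis k E
  have hsum : ∀ s : Finset (Fin (Module.finrank k E)), RadEquiv M r θ
      (θ + ∑ i ∈ s, (b.coord i).smulRight (φ (b i))) := by
    intro s
    induction s using Finset.induction_on with
    | empty =>
      rw [Finset.sum_empty, add_zero]
      exact fun _ _ => Iff.rfl
    | insert i s hi ih =>
      rw [Finset.sum_insert hi, add_comm (smulRight _ _), ← add_assoc]
      refine fun U d => (ih U d).trans (radEquiv_add_smulRight r hJ N 2 le_rfl hN' _ (hφ _) _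
        (fun c hc => ?_) _ U d)
      obtain ⟨e, he⟩ := hθ c hc
      refine ⟨e, ?_⟩
      rw [LinearMap.add_apply, ← sub_sub, LinearMap.sum_apply]
      exact sub_mem he (sum_mem fun j _ => Submodule.smul_of_tower_mem _ _ (hφ _))
  have := hsum Finset.univ
  convert this using 2
  refine b.ext fun j => ?_
  simp [LinearMap.sum_apply, Finsupp.single_apply]

end RadicalFamily

theorem radPow_one_map {k A M E : Type*} [Field k] [CommRing A] [Algebra k A] [AddCommGroup M]
    [Module A M] [AddCommGroup E] [Module k E] [Module k M] [IsScalarTower k A M]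
    (θ : E →ₗ[k] A) (U : Submodule k E) :
    radPow k A M (U.map θ : Set A) 1 = (radSub M θ U).restrictScalars k := by
  apply le_antisymm
  · refine iSup₂_le fun u hu => ?_
    rintro _ ⟨m, rfl⟩
    obtain ⟨x, hx, hxu⟩ := hu 0
    refine subset_span ⟨x, hx, m, ?_⟩
    rw [hxu]
    simp [smulLinear]
  · intro y hy
    have hgen : ∀ x ∈ U, ∀ m : M, θ x • m ∈ radPow k A M (U.map θ : Set A) 1 := fun x hx m =>
      le_iSup₂_of_le (f := fun (u : Fin 1 → A) (_ : ∀ i, u i ∈ (U.map θ : Set A)) =>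
        range (smulLinear k M (∏ i, u i))) (fun _ => θ x) (fun _ => ⟨x, hx, rfl⟩) le_rfl
        ⟨m, by simp [smulLinear]⟩
    have hsmul : ∀ a : A, ∀ y ∈ radPow k A M (U.map θ : Set A) 1,
        a • y ∈ radPow k A M (U.map θ : Set A) 1 := by
      intro a y hy
      suffices h : radPow k A M (U.map θ : Set A) 1 ≤
          (radPow k A M (U.map θ : Set A) 1).comap (smulLinear k M a) from h hy
      refine iSup₂_le fun u hu => ?_
      rintro _ ⟨m, rfl⟩
      obtain ⟨x, hx, hxu⟩ := hu 0
      have := hgen x hx (a • m)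
      rw [smul_comm] at this
      simpa [smulLinear, ← hxu] using this
    change y ∈ radSub M θ U at hy
    induction hy using span_induction with
    | mem y h => obtain ⟨x, hx, m, rfl⟩ := h; exact hgen x hx m
    | zero => exact zero_mem _
    | add y z _ _ hy hz => exact add_mem hy hz
    | smul a y _ hy => exact hsmul a y hy

theorem sSup_finrank_radPow {k A M E : Type*} [Field k] [CommRing A] [Algebra k A]
    [AddCommGroup M] [Module A M] [AddCommGroup E] [Module k E] [Module k M] [IsScalarTower k A M]
    {θ : E →ₗ[k] A} (hθ : Function.Injective θ) (r : ℕ) :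
    {d : ℕ | ∃ U : Submodule k A, U ≤ range θ ∧ Module.finrank k U = r ∧
        d = Module.finrank k (radPow k A M (U : Set A) 1)} =
      {d : ℕ | ∃ U : Submodule k E, Module.finrank k U = r ∧
        d = Module.finrank k (radSub M θ U)} := by
  ext d
  constructor
  · rintro ⟨U, hU, rfl, rfl⟩
    refine ⟨U.comap θ, ?_, ?_⟩
    · rw [((U.comap θ).equivMapOfInjective θ hθ).finrank_eq, map_comap_eq_self hU]
    · have := radPow_one_map (M := M) θ (U.comap θ)
      rw [map_comap_eq_self hU] at this
      rw [this]
      rfl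
  · rintro ⟨U, rfl, rfl⟩
    refine ⟨U.map θ, map_le_range, (U.equivMapOfInjective θ hθ).finrank_eq.symm, ?_⟩
    rw [radPow_one_map]
    rfl

theorem isMaxRad_iff_eq_sSup {k A M E : Type*} [Field k] [CommRing A] [Algebra k A]
    [AddCommGroup M] [Module A M] [AddCommGroup E] [Module k E] [Module k M] [IsScalarTower k A M]
    [FiniteDimensional k M] (θ : E →ₗ[k] A) {U : Submodule k E} {r : ℕ}
    (hU : Module.finrank k U = r) :
    IsMaxRad M r θ U ↔ Module.finrank k (radSub M θ U) =
      sSup {d : ℕ | ∃ U : Submodule k E, Module.finrank k U = r ∧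
        d = Module.finrank k (radSub M θ U)} := by
  have hs : BddAbove {d : ℕ | ∃ U : Submodule k E, Module.finrank k U = r ∧
      d = Module.finrank k (radSub M θ U)} := by
    refine ⟨Module.finrank k M, ?_⟩
    rintro _ ⟨U, _, rfl⟩
    exact ((radSub M θ U).restrictScalars k).finrank_le
  constructor
  · intro h
    refine le_antisymm (le_csSup hs ⟨U, hU, rfl⟩) (csSup_le ⟨_, U, hU, rfl⟩ ?_)
    rintro _ ⟨U₀, h₀, rfl⟩
    exact h.2 U₀ h₀
  · intro h
    exact ⟨hU, fun U₀ h₀ => h ▸ le_csSup hs ⟨U₀, h₀, rfl⟩⟩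

theorem xGen_pow_eq_zero (k : Type*) [Field k] (n p : ℕ) (i : Fin n) : xGen k n p i ^ p = 0 := by
  rw [xGen, ← map_pow, Ideal.Quotient.eq_zero_iff_mem]
  exact Ideal.subset_span ⟨i, rfl⟩

theorem isNilpotent_radIdeal (k : Type*) [Field k] (n p : ℕ) : IsNilpotent (radIdeal k n p) := by
  have hfg : (radIdeal k n p).FG := ⟨(Set.finite_range (xGen k n p)).toFinset, by
    rw [Set.Finite.coe_toFinset]; rfl⟩
  rw [hfg.isNilpotent_iff_le_nilradical, radIdeal, Ideal.span_le]
  rintro _ ⟨i, rfl⟩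
  exact ⟨p, xGen_pow_eq_zero k n p i⟩

theorem finiteDimensional_truncAlg (k : Type*) [Field k] (n : ℕ) {p : ℕ} (hp : 0 < p) :
    FiniteDimensional k (TruncAlg k n p) := by
  have htop : Algebra.adjoin k (Set.range (xGen k n p)) = ⊤ := by
    have h := congrArg (Subalgebra.map (Ideal.Quotient.mkₐ k (truncIdeal k n p)))
      (MvPolynomial.adjoin_range_X (R := k) (σ := Fin n))
    rw [AlgHom.map_adjoin, Algebra.map_top, (AlgHom.range_eq_top _).2
      (Ideal.Quotient.mkₐ_surjective k _), ← Set.range_comp] at h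
    exact h
  have hfg := fg_adjoin_of_finite (R := k) (Set.finite_range (xGen k n p)) (by
    rintro _ ⟨i, rfl⟩
    exact IsIntegral.of_pow hp (by rw [xGen_pow_eq_zero]; exact isIntegral_zero))
  rw [htop] at hfg
  exact ⟨by simpa using hfg⟩

end MaximalRadicals

/-- Independence of the choice of splitting `V` of `Rad(A) → Rad(A)/Rad²(A)`:
for the canonical isomorphism `ψ : V → W` (characterized by `ψ(v) − v ∈ Rad²(A)`),
(a) the maximal `r`-radical rank of `M` computed in `V` equals that computed in `W`;
(b) if `U ⊆ V` attains the maximum then `dim Rad_{ψ(U)}(M) = dim Rad_U(M)`;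
(c) `U` attains the maximum iff `ψ(U)` does. -/
theorem statement9 {k : Type*} [Field k] [IsAlgClosed k] (p n r : ℕ) [Fact p.Prime]
    [CharP k p] (hr : 1 ≤ r) (hrn : r ≤ n)
    (V W : Submodule k (TruncAlg k n p))
    (hV1 : V ⊓ Submodule.restrictScalars k ((radIdeal k n p) ^ 2 : Ideal (TruncAlg k n p)) = ⊥)
    (hV2 : V ⊔ Submodule.restrictScalars k ((radIdeal k n p) ^ 2 : Ideal (TruncAlg k n p)) =
      Submodule.restrictScalars k (radIdeal k n p))
    (hW1 : W ⊓ Submodule.restrictScalars k ((radIdeal k n p) ^ 2 : Ideal (TruncAlg k n p)) = ⊥)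
    (hW2 : W ⊔ Submodule.restrictScalars k ((radIdeal k n p) ^ 2 : Ideal (TruncAlg k n p)) =
      Submodule.restrictScalars k (radIdeal k n p))
    (ψ : V ≃ₗ[k] W)
    (hψ : ∀ v : V, ((ψ v : TruncAlg k n p) - (v : TruncAlg k n p)) ∈
      ((radIdeal k n p) ^ 2 : Ideal (TruncAlg k n p)))
    (M : Type*) [AddCommGroup M] [Module k M] [Module (TruncAlg k n p) M]
    [IsScalarTower k (TruncAlg k n p) M] [FiniteDimensional k M] :
    (sSup {d : ℕ | ∃ U : Submodule k (TruncAlg k n p), U ≤ V ∧ Module.finrank k U = r ∧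
        d = Module.finrank k
          ↥(radPow k (TruncAlg k n p) M (U : Set (TruncAlg k n p)) 1)} =
      sSup {d : ℕ | ∃ U' : Submodule k (TruncAlg k n p), U' ≤ W ∧ Module.finrank k U' = r ∧
        d = Module.finrank k
          ↥(radPow k (TruncAlg k n p) M (U' : Set (TruncAlg k n p)) 1)}) ∧
    (∀ U : Submodule k (TruncAlg k n p), U ≤ V → Module.finrank k U = r →
      Module.finrank k ↥(radPow k (TruncAlg k n p) M (U : Set (TruncAlg k n p)) 1) =
        sSup {d : ℕ | ∃ U₀ : Submodule k (TruncAlg k n p), U₀ ≤ V ∧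
          Module.finrank k U₀ = r ∧
          d = Module.finrank k
            ↥(radPow k (TruncAlg k n p) M (U₀ : Set (TruncAlg k n p)) 1)} →
      Module.finrank k
          ↥(radPow k (TruncAlg k n p) M
            ((Submodule.map (W.subtype.comp ψ.toLinearMap)
              (U.comap V.subtype) : Submodule k (TruncAlg k n p)) :
                Set (TruncAlg k n p)) 1) =
        Module.finrank k ↥(radPow k (TruncAlg k n p) M (U : Set (TruncAlg k n p)) 1)) ∧
    (∀ U : Submodule k (TruncAlg k n p), U ≤ V → Module.finrank k U = r →
      (Module.finrank k ↥(radPow k (TruncAlg k n p) M (U : Set (TruncAlg k n p)) 1) =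
          sSup {d : ℕ | ∃ U₀ : Submodule k (TruncAlg k n p), U₀ ≤ V ∧
            Module.finrank k U₀ = r ∧
            d = Module.finrank k
              ↥(radPow k (TruncAlg k n p) M (U₀ : Set (TruncAlg k n p)) 1)} ↔
        Module.finrank k
            ↥(radPow k (TruncAlg k n p) M
              ((Submodule.map (W.subtype.comp ψ.toLinearMap)
                (U.comap V.subtype) : Submodule k (TruncAlg k n p)) :
                  Set (TruncAlg k n p)) 1) =
          sSup {d : ℕ | ∃ U' : Submodule k (TruncAlg k n p), U' ≤ W ∧
            Module.finrank k U' = r ∧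
            d = Module.finrank k
              ↥(radPow k (TruncAlg k n p) M (U' : Set (TruncAlg k n p)) 1)})) := by
  have hp : 0 < p := (Fact.out : p.Prime).pos
  have := finiteDimensional_truncAlg k n hp
  have : Infinite k := IsAlgClosed.instInfinite
  let θ : V →ₗ[k] TruncAlg k n p := V.subtype
  let θ' : V →ₗ[k] TruncAlg k n p := W.subtype.comp ψ.toLinearMap
  have hθ : Function.Injective θ := V.injective_subtype
  have hθ' : Function.Injective θ' := W.injective_subtype.comp ψ.injective
  have hrange : LinearMap.range θ = V := V.range_subtype
  have hrange' : LinearMap.range θ' = W := by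
    rw [LinearMap.range_comp, LinearEquiv.range, Submodule.map_top, W.range_subtype]
  have hequiv : RadEquiv M r θ θ' := by
    have h := radEquiv_add (M := M) (θ := θ) (φ := θ' - θ) r (isNilpotent_radIdeal k n p) ?_ hψ
    · rwa [add_sub_cancel] at h
    · intro b hb
      have hb' : b ∈ V ⊔ Submodule.restrictScalars k
          ((radIdeal k n p) ^ 2 : Ideal (TruncAlg k n p)) := by rw [hV2]; exact hb
      obtain ⟨v, hv, c, hc, rfl⟩ := Submodule.mem_sup.1 hb'
      exact ⟨⟨v, hv⟩, by simpa [θ] using hc⟩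
  have hmax : ∀ U, IsMaxRad M r θ U → IsMaxRad M r θ' U ∧
      Module.finrank k (radSub M θ' U) = Module.finrank k (radSub M θ U) :=
    fun U hU => (hequiv U _).1 ⟨hU, rfl⟩
  have hmax' : ∀ U, IsMaxRad M r θ' U → IsMaxRad M r θ U := fun U hU =>
    ((hequiv U _).2 ⟨hU, rfl⟩).1
  have hsV := sSup_finrank_radPow (M := M) hθ r
  have hsW := sSup_finrank_radPow (M := M) hθ' r
  rw [hrange] at hsV
  rw [hrange'] at hsW
  rw [hsV, hsW]
  have hU : ∀ U : Submodule k (TruncAlg k n p), U ≤ V → Module.finrank k U = r →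
      Module.finrank k (U.comap V.subtype) = r ∧
      Module.finrank k (radPow k (TruncAlg k n p) M (U : Set (TruncAlg k n p)) 1) =
        Module.finrank k (radSub M θ (U.comap V.subtype)) ∧
      Module.finrank k (radPow k (TruncAlg k n p) M
        ((U.comap V.subtype).map (W.subtype.comp ψ.toLinearMap) : Set (TruncAlg k n p)) 1) =
        Module.finrank k (radSub M θ' (U.comap V.subtype)) := by
    intro U hUV hUr
    have hm : (U.comap V.subtype).map θ = U :=
      Submodule.map_comap_eq_self (hUV.trans hrange.ge)
    refine ⟨?_, ?_, ?_⟩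
    · rw [((U.comap V.subtype).equivMapOfInjective θ hθ).finrank_eq, hm, hUr]
    · have := radPow_one_map (M := M) θ (U.comap V.subtype)
      rw [hm] at this
      rw [this]
      rfl
    · rw [radPow_one_map (M := M) θ' (U.comap V.subtype)]
      rfl
  refine ⟨?_, fun U hUV hUr => ?_, fun U hUV hUr => ?_⟩
  · by_cases hne : ∃ U : Submodule k V, Module.finrank k U = r
    · obtain ⟨U₀, h₀⟩ := hne
      obtain ⟨U, hUm⟩ := exists_isMaxRad (M := M) θ h₀
      rw [← (isMaxRad_iff_eq_sSup θ hUm.1).1 hUm, ← (hmax U hUm).2]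
      exact (isMaxRad_iff_eq_sSup θ' hUm.1).1 (hmax U hUm).1
    · congr 1
      ext d
      constructor
      · rintro ⟨U, h, _⟩; exact absurd ⟨U, h⟩ hne
      · rintro ⟨U, h, _⟩; exact absurd ⟨U, h⟩ hne
  · obtain ⟨h₁, h₂, h₃⟩ := hU U hUV hUr
    rw [h₂, h₃, ← isMaxRad_iff_eq_sSup θ h₁]
    exact fun h => (hmax _ h).2
  · obtain ⟨h₁, h₂, h₃⟩ := hU U hUV hUr
    rw [h₂, h₃, ← isMaxRad_iff_eq_sSup θ h₁, ← isMaxRad_iff_eq_sSup θ' h₁]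
    exact ⟨fun h => (hmax _ h).1, hmax' _⟩

end
end

section
/- Let V, W ⊆ Rad(A) be two n-dimensional k-subspaces each of which maps isomorphically onto Rad(A)/Rad²(A), and let ψ : V → W be the unique k-linear isomorphism such that ψ(v) − v ∈ Rad²(A) for all v ∈ V. Let M be a finite-dimensional A-module. Then for every r-dimensional subspace U ⊆ V, the restriction α_U^*(M) is free as a C-module if and only if α_{ψ(U)}^*(M) is free as a C-module. -/
open scoped TensorProduct

set_option synthInstance.maxHeartbeats 1000000
set_option maxHeartbeats 1000000

noncomputable section

section LinearAlgebra

open Module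

variable {k N : Type*} [Field k] [AddCommGroup N] [Module k N] [FiniteDimensional k N]

theorem finrank_ker_comp_eq {N₁ N₂ : Type*} [AddCommGroup N₁] [Module k N₁]
    [AddCommGroup N₂] [Module k N₂] (f : N₁ →ₗ[k] N₂) (g : N →ₗ[k] N₁) :
    finrank k (LinearMap.ker (f ∘ₗ g)) =
      finrank k (LinearMap.ker g) +
        finrank k (LinearMap.range g ⊓ LinearMap.ker f : Submodule k N₁) := by
  have hle : LinearMap.ker g ≤ LinearMap.ker (f ∘ₗ g) := LinearMap.ker_le_ker_comp g f
  have h := LinearMap.finrank_range_add_finrank_ker (g.domRestrict (LinearMap.ker (f ∘ₗ g)))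
  have hr : LinearMap.range (g.domRestrict (LinearMap.ker (f ∘ₗ g))) =
      LinearMap.range g ⊓ LinearMap.ker f := by
    rw [LinearMap.range_domRestrict, LinearMap.ker_comp, Submodule.map_comap_eq]
  have hk : finrank k (LinearMap.ker (g.domRestrict (LinearMap.ker (f ∘ₗ g)))) =
      finrank k (LinearMap.ker g) := by
    rw [LinearMap.ker_domRestrict]
    exact (Submodule.comapSubtypeEquivOfLe hle).finrank_eq
  rw [hr, hk] at h
  omega

theorem finrank_ker_pow_succ (T : N →ₗ[k] N) (i : ℕ) :
    finrank k (LinearMap.ker (T ^ (i + 1))) =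
      finrank k (LinearMap.ker (T ^ i)) +
        finrank k (LinearMap.range (T ^ i) ⊓ LinearMap.ker T : Submodule k N) := by
  rw [pow_succ']
  exact finrank_ker_comp_eq T (T ^ i)

theorem finrank_ker_pow_le (T : N →ₗ[k] N) (i : ℕ) :
    finrank k (LinearMap.ker (T ^ i)) ≤ i * finrank k (LinearMap.ker T) := by
  induction i with
  | zero => simp [Module.End.one_eq_id]
  | succ i ih =>
    have h := Submodule.finrank_mono
      (inf_le_right : LinearMap.range (T ^ i) ⊓ LinearMap.ker T ≤ LinearMap.ker T)
    rw [finrank_ker_pow_succ, add_one_mul]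
    omega

theorem finrank_le_mul_finrank_ker {T : N →ₗ[k] N} {q : ℕ} (hT : T ^ q = 0) :
    finrank k N ≤ q * finrank k (LinearMap.ker T) := by
  have h := finrank_ker_pow_le T q
  rwa [hT, LinearMap.ker_zero, finrank_top] at h

theorem finrank_eq_mul_finrank_ker {T : N →ₗ[k] N} {q : ℕ} (hT : T ^ q = 0)
    (h : LinearMap.ker T ≤ LinearMap.range (T ^ (q - 1))) :
    finrank k N = q * finrank k (LinearMap.ker T) := by
  have key : ∀ i ≤ q, finrank k (LinearMap.ker (T ^ i)) = i * finrank k (LinearMap.ker T) := by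
    intro i
    induction i with
    | zero => simp [Module.End.one_eq_id]
    | succ i ih =>
      intro hi
      have hle : LinearMap.ker T ≤ LinearMap.range (T ^ i) := by
        refine h.trans ?_
        obtain ⟨j, hj⟩ := Nat.exists_eq_add_of_le (show i ≤ q - 1 by omega)
        rw [hj, pow_add]
        exact LinearMap.range_comp_le_range _ _
      rw [finrank_ker_pow_succ, inf_eq_right.2 hle, ih (by omega), add_one_mul]
  have h' := key q le_rfl
  rwa [hT, LinearMap.ker_zero, finrank_top] at h'

theorem ker_le_range_of_finrank_eq {T : N →ₗ[k] N} {q : ℕ} (hq : 0 < q) (hT : T ^ q = 0)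
    (h : finrank k N = q * finrank k (LinearMap.ker T)) :
    LinearMap.ker T ≤ LinearMap.range (T ^ (q - 1)) ∧
      LinearMap.ker (T ^ (q - 1)) ≤ LinearMap.range T := by
  obtain ⟨q, rfl⟩ := Nat.exists_eq_add_of_le' hq
  rw [Nat.add_sub_cancel]
  have h₁ := LinearMap.finrank_range_add_finrank_ker (T ^ q)
  have h₂ := finrank_ker_pow_le T q
  have h₃ := LinearMap.finrank_range_add_finrank_ker T
  have hr : LinearMap.range (T ^ q) ≤ LinearMap.ker T :=
    LinearMap.range_le_ker_iff.2 (by rw [← Module.End.mul_eq_comp, ← pow_succ', hT])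
  have hr' : LinearMap.range T ≤ LinearMap.ker (T ^ q) :=
    LinearMap.range_le_ker_iff.2 (by rw [← Module.End.mul_eq_comp, ← pow_succ, hT])
  have h₄ := Submodule.finrank_mono hr
  rw [Nat.succ_eq_add_one, zero_add, add_one_mul] at h
  exact ⟨(Submodule.eq_of_le_of_finrank_eq hr (by omega)).ge,
    (Submodule.eq_of_le_of_finrank_eq hr' (by omega)).ge⟩

end LinearAlgebra

section PolynomialModule

open Polynomial

variable {A M : Type*} [CommRing A] [AddCommGroup M] [Module A M]

theorem PolynomialModule.exists_eq_single_add_X_smul (q : PolynomialModule A M) :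
    ∃ q', q = PolynomialModule.single A 0 (PolynomialModule.eval (0 : A) q) + (X : A[X]) • q' := by
  induction q using PolynomialModule.induction_linear with
  | zero => exact ⟨0, by simp⟩
  | add f g hf hg =>
    obtain ⟨f', hf⟩ := hf
    obtain ⟨g', hg⟩ := hg
    refine ⟨f' + g', ?_⟩
    rw [map_add, PolynomialModule.single_add, smul_add]
    nth_rewrite 1 [hf, hg]
    abel
  | single i m =>
    cases i with
    | zero => exact ⟨0, by simp⟩
    | succ i =>
      refine ⟨PolynomialModule.single A i m, ?_⟩
      rw [← Polynomial.monomial_one_one_eq_X, PolynomialModule.monomial_smul_single]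
      simp [add_comm]

theorem PolynomialModule.X_smul_injective :
    Function.Injective fun q : PolynomialModule A M => (X : A[X]) • q := by
  intro q q' h
  apply PolynomialModule.coeff_injective
  ext n
  have h' := congrArg (fun q => PolynomialModule.coeff q (n + 1)) h
  simpa [← Polynomial.monomial_one_one_eq_X, PolynomialModule.monomial_smul_apply] using h'

theorem PolynomialModule.X_pow_smul_injective (j : ℕ) :
    Function.Injective fun q : PolynomialModule A M => (X : A[X]) ^ j • q := by
  induction j with
  | zero => intro q q' h; simpa using h
  | succ j ih =>
    intro q q' h
    simp only [pow_succ, mul_smul] at h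
    exact PolynomialModule.X_smul_injective (ih h)

end PolynomialModule

section Exactness

open Polynomial

variable {A M : Type*} [CommRing A] [AddCommGroup M] [Module A M]

theorem exists_eq_smul_add_X_pow_smul {f g : A[X]} (hfg : f * g = 0)
    (hex : ∀ m : M, f.eval 0 • m = 0 → ∃ n : M, m = g.eval 0 • n) (J : ℕ)
    {y : PolynomialModule A M} (hy : ∃ y', f • y = (X : A[X]) ^ J • y') :
    ∃ z y', y = g • z + (X : A[X]) ^ J • y' := by
  suffices h : ∀ j ≤ J, ∃ z y', y = g • z + (X : A[X]) ^ j • y' from h J le_rfl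
  intro j
  induction j with
  | zero => exact fun _ => ⟨0, y, by simp⟩
  | succ j ih =>
    intro hj
    obtain ⟨z, y', hz⟩ := ih (by omega)
    obtain ⟨w, hw⟩ := hy
    obtain ⟨i, rfl⟩ := Nat.exists_eq_add_of_le hj
    have h₁ : f • y' = (X : A[X]) • (X : A[X]) ^ i • w := by
      apply PolynomialModule.X_pow_smul_injective j
      simp only
      rw [hz, smul_add, smul_smul, hfg, zero_smul, zero_add, smul_comm] at hw
      rw [hw, smul_smul, smul_smul, pow_add, pow_succ, mul_assoc]
    have h₂ := congrArg (PolynomialModule.eval (0 : A)) h₁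
    rw [PolynomialModule.eval_smul, PolynomialModule.eval_smul, eval_X, zero_smul] at h₂
    obtain ⟨n, hn⟩ := hex _ h₂
    obtain ⟨y₁, hy₁⟩ := PolynomialModule.exists_eq_single_add_X_smul y'
    obtain ⟨y₂, hy₂⟩ :=
      PolynomialModule.exists_eq_single_add_X_smul (g • PolynomialModule.single A 0 n)
    rw [PolynomialModule.eval_smul, PolynomialModule.eval_single, pow_zero, one_smul, ← hn,
      ← sub_eq_iff_eq_add] at hy₂
    refine ⟨z + (X : A[X]) ^ j • PolynomialModule.single A 0 n, y₁ - y₂, ?_⟩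
    rw [hz, hy₁, ← hy₂]
    module

theorem exists_eq_add_mul_pow_smul (p : ℕ) [Fact p.Prime] [CharP A p] {t a b : A}
    (ht : t ^ p = 0) (ha : a ^ p = 0) (hb : b ^ p = 0)
    (h₁ : ∀ m : M, t • m = 0 → ∃ n : M, m = t ^ (p - 1) • n)
    (h₂ : ∀ m : M, t ^ (p - 1) • m = 0 → ∃ n : M, m = t • n)
    (m : M) (hm : (t + a * b) • m = 0) :
    ∃ n : M, m = (t + a * b) ^ (p - 1) • n := by
  have hp := (Fact.out : p.Prime).pos
  have hpp : p - 1 + 1 = p := by omega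
  let f : A[X] := C t + X * C b
  let s : A[X] := X - C a
  have hf₀ : f.eval 0 = t := by simp [f]
  have hfa : f.eval a = t + a * b := by simp only [f, eval_add, eval_C, eval_mul, eval_X]
  have hfs : f = C (t + a * b) + s * C b := by simp only [f, s, C_add, C_mul]; ring
  have hfp : f ^ p = 0 := by
    simp only [f]
    rw [add_pow_char, mul_pow, ← C_pow, ← C_pow, ht, hb]
    simp
  have hsp : s ^ p = X ^ p := by
    simp only [s]
    rw [sub_pow_char, ← C_pow, ha, C_0, sub_zero]
  have hff : f * f ^ (p - 1) = 0 := by rw [← pow_succ', hpp, hfp]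
  have hff' : f ^ (p - 1) * f = 0 := by rw [← pow_succ, hpp, hfp]
  let e : PolynomialModule A M := PolynomialModule.single A 0 m
  have he : C (t + a * b) • e = 0 := by
    simp only [e]
    rw [← monomial_zero_left, PolynomialModule.monomial_smul_single, hm,
      PolynomialModule.single_zero]
  have hfe : f • e = s • C b • e := by
    rw [hfs, add_smul, he, zero_add, mul_smul]
  have hfbe : f ^ (p - 1) • C b • e = 0 := by
    obtain ⟨c, hc⟩ := sub_dvd_pow_sub_pow f (s * C b) (p - 1)
    rw [sub_eq_iff_eq_add, show f - s * C b = C (t + a * b) by rw [hfs]; ring] at hc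
    have hz : (s * C b) ^ (p - 1) * C b = 0 := by
      rw [mul_pow, mul_assoc, ← pow_succ, hpp, ← C_pow, hb, C_0, mul_zero]
    rw [smul_smul, hc, add_mul, hz, add_zero,
      show C (t + a * b) * c * C b = (c * C b) * C (t + a * b) by ring, mul_smul, he, smul_zero]
  obtain ⟨z, y, hzy⟩ := exists_eq_smul_add_X_pow_smul (M := M) hff'
    (by simpa only [eval_pow, hf₀] using h₂) p ⟨0, by rw [hfbe, smul_zero]⟩
  obtain ⟨q, w, hqw⟩ := exists_eq_smul_add_X_pow_smul (M := M) (y := e - s • z) hff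
    (by simpa only [eval_pow, hf₀] using h₁) p
    ⟨s • y, by rw [smul_sub, hfe, hzy]; module⟩
  have h := congrArg (PolynomialModule.eval a) hqw
  simp only [map_sub, map_add, PolynomialModule.eval_smul, eval_pow, hfa, eval_X, ha, zero_smul,
    add_zero] at h
  refine ⟨_, Eq.trans ?_ h⟩
  simp [e, s]

end Exactness

section Coinvariants

open Module

variable {k A M : Type*} [Field k] [CommRing A] [Algebra k A] [AddCommGroup M] [Module k M]
  [Module A M] [IsScalarTower k A M]

theorem finrank_quotient_sup_smul_top (I J : Ideal A) :
    finrank k ((M ⧸ (I • ⊤ : Submodule A M)) ⧸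
      (J • ⊤ : Submodule A (M ⧸ (I • ⊤ : Submodule A M)))) =
      finrank k (M ⧸ ((I ⊔ J) • ⊤ : Submodule A M)) := by
  have hJ : (J • ⊤ : Submodule A (M ⧸ (I • ⊤ : Submodule A M))) =
      (J • ⊤ : Submodule A M).map (I • ⊤ : Submodule A M).mkQ := by
    rw [Submodule.map_smul'', Submodule.map_top, Submodule.range_mkQ]
  rw [hJ, Submodule.sup_smul]
  exact ((Submodule.quotientQuotientEquivQuotientSup (I • ⊤ : Submodule A M)
    (J • ⊤ : Submodule A M)).restrictScalars k).finrank_eq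

theorem finrank_quotient_bot_smul_top :
    finrank k (M ⧸ ((⊥ : Ideal A) • ⊤ : Submodule A M)) = finrank k M := by
  rw [Submodule.bot_smul]
  exact ((Submodule.quotEquivOfEqBot (⊥ : Submodule A M) rfl).restrictScalars k).finrank_eq

variable [FiniteDimensional k M]

theorem finrank_quotient_span_singleton_smul_top (t : A) :
    finrank k (M ⧸ (Ideal.span {t} • ⊤ : Submodule A M)) =
      finrank k (LinearMap.ker (Algebra.lsmul k k M t)) := by
  have hr : (Ideal.span {t} • ⊤ : Submodule A M).restrictScalars k =
      LinearMap.range (Algebra.lsmul k k M t) := by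
    ext m
    rw [Submodule.restrictScalars_mem, Submodule.ideal_span_singleton_smul,
      Submodule.mem_smul_pointwise_iff_exists]
    simp
  have h₁ := LinearMap.finrank_range_add_finrank_ker (Algebra.lsmul k k M t)
  have h₂ := Submodule.finrank_quotient_add_finrank
    ((Ideal.span {t} • ⊤ : Submodule A M).restrictScalars k)
  rw [(Submodule.Quotient.restrictScalarsEquiv k _).finrank_eq, hr] at h₂
  omega

theorem finrank_quotient_smul_top_le {t : A} {q : ℕ} (ht : t ^ q = 0) (I : Ideal A) :
    finrank k (M ⧸ (I • ⊤ : Submodule A M)) ≤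
      q * finrank k (M ⧸ ((I ⊔ Ideal.span {t}) • ⊤ : Submodule A M)) := by
  rw [← finrank_quotient_sup_smul_top, finrank_quotient_span_singleton_smul_top]
  exact finrank_le_mul_finrank_ker (by rw [← map_pow, ht, map_zero])

theorem finrank_le_pow_card_mul {ι : Type*} {v : ι → A} {q : ℕ} (s : Finset ι)
    (hv : ∀ i ∈ s, v i ^ q = 0) :
    finrank k M ≤
      q ^ s.card * finrank k (M ⧸ (Ideal.span (v '' s) • ⊤ : Submodule A M)) := by
  classical
  induction s using Finset.induction_on with
  | empty =>
    rw [Finset.coe_empty, Set.image_empty, Ideal.span_empty, finrank_quotient_bot_smul_top]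
    simp
  | insert i s hi ih =>
    refine (ih fun j hj => hv j (Finset.mem_insert_of_mem hj)).trans ?_
    rw [Finset.card_insert_of_notMem hi, pow_succ, mul_assoc, Finset.coe_insert,
      Set.image_insert_eq, Set.insert_eq, Ideal.span_union, sup_comm]
    exact Nat.mul_le_mul_left _
      (finrank_quotient_smul_top_le (hv i (Finset.mem_insert_self i s)) _)

variable (k M) in
theorem finrank_eq_add_mul (p : ℕ) [Fact p.Prime] [CharP A p] {t a b : A}
    (ht : t ^ p = 0) (ha : a ^ p = 0) (hb : b ^ p = 0)
    (h : finrank k M = p * finrank k (M ⧸ (Ideal.span {t} • ⊤ : Submodule A M))) :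
    finrank k M = p * finrank k (M ⧸ (Ideal.span {t + a * b} • ⊤ : Submodule A M)) := by
  have hp := (Fact.out : p.Prime).pos
  rw [finrank_quotient_span_singleton_smul_top] at h ⊢
  obtain ⟨h₁, h₂⟩ := ker_le_range_of_finrank_eq hp (by rw [← map_pow, ht, map_zero]) h
  have htab : (t + a * b) ^ p = 0 := by
    rw [add_pow_char, mul_pow, ht, ha, zero_mul, add_zero]
  refine finrank_eq_mul_finrank_ker (by rw [← map_pow, htab, map_zero]) fun m hm => ?_
  rw [← map_pow] at h₁ h₂ ⊢
  obtain ⟨n, hn⟩ := exists_eq_add_mul_pow_smul p ht ha hb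
    (fun m hm => (h₁ hm).imp fun n hn => hn.symm) (fun m hm => (h₂ hm).imp fun n hn => hn.symm)
    m hm
  exact ⟨n, hn.symm⟩

variable (k M) in
theorem finrank_eq_add_of_mem_sq (p : ℕ) [Fact p.Prime] [CharP A p] {R : Ideal A}
    (hR : ∀ x ∈ R, x ^ p = 0) {t e : A} (ht : t ∈ R) (he : e ∈ R ^ 2)
    (h : finrank k M = p * finrank k (M ⧸ (Ideal.span {t} • ⊤ : Submodule A M))) :
    finrank k M = p * finrank k (M ⧸ (Ideal.span {t + e} • ⊤ : Submodule A M)) := by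
  rw [pow_two] at he
  induction he using Submodule.mul_induction_on' generalizing t with
  | mem_mul_mem a ha b hb => exact finrank_eq_add_mul k M p (hR t ht) (hR a ha) (hR b hb) h
  | add x hx y hy ihx ihy =>
    rw [← add_assoc]
    exact ihy (R.add_mem ht (Ideal.mul_le_left hx)) (ihx ht h)

variable (k M) in
theorem finrank_eq_pow_mul_update (p : ℕ) [Fact p.Prime] [CharP A p] {R : Ideal A}
    (hR : ∀ x ∈ R, x ^ p = 0) {ι : Type*} [Fintype ι] [DecidableEq ι] {v : ι → A}
    (hv : ∀ i, v i ∈ R) (i : ι) {e : A} (he : e ∈ R ^ 2)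
    (h : finrank k M = p ^ Fintype.card ι *
      finrank k (M ⧸ (Ideal.span (Set.range v) • ⊤ : Submodule A M))) :
    finrank k M = p ^ Fintype.card ι * finrank k (M ⧸
      (Ideal.span (Set.range (Function.update v i (v i + e))) • ⊤ : Submodule A M)) := by
  have hp := (Fact.out : p.Prime).pos
  let I : Ideal A := Ideal.span (v '' (Finset.univ.erase i : Finset ι))
  have hI : ∀ x : A, Ideal.span (Set.range (Function.update v i x)) = I ⊔ Ideal.span {x} := by
    intro x
    rw [← Ideal.span_union]
    congr 1
    ext y
    simp only [Set.mem_range, Set.mem_union, Set.mem_image, Finset.coe_erase, Finset.coe_univ,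
      Set.mem_sdiff, Set.mem_univ, true_and, Set.mem_singleton_iff]
    constructor
    · rintro ⟨j, rfl⟩
      by_cases hj : j = i
      · subst hj
        exact Or.inr (Function.update_self ..)
      · exact Or.inl ⟨j, hj, (Function.update_of_ne hj ..).symm⟩
    · rintro (⟨j, hj, rfl⟩ | rfl)
      · exact ⟨j, Function.update_of_ne hj ..⟩
      · exact ⟨i, Function.update_self ..⟩
  have hvI := hI (v i)
  rw [Function.update_eq_self] at hvI
  have hcard : Fintype.card ι = (Finset.univ.erase i).card + 1 := by
    rw [Finset.card_erase_add_one (Finset.mem_univ i), Finset.card_univ]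
  have hM := finrank_le_pow_card_mul (k := k) (M := M) (q := p) (v := v) (Finset.univ.erase i)
    fun j _ => hR _ (hv j)
  have hMI := finrank_quotient_smul_top_le (k := k) (M := M) (hR _ (hv i)) I
  rw [hvI, hcard, pow_succ, mul_assoc] at h
  rw [hI, hcard, pow_succ, mul_assoc]
  have hpos : 0 < p ^ (Finset.univ.erase i).card := pow_pos hp _
  have heq : finrank k (M ⧸ (I • ⊤ : Submodule A M)) =
      p * finrank k (M ⧸ ((I ⊔ Ideal.span {v i}) • ⊤ : Submodule A M)) :=
    hMI.antisymm (Nat.le_of_mul_le_mul_left (h ▸ hM) hpos)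
  rw [h, ← heq]
  rw [← finrank_quotient_sup_smul_top] at heq ⊢
  rw [← finrank_eq_add_of_mem_sq k _ p hR (hv i) he heq]

variable (k M) in
theorem finrank_eq_pow_mul_of_sub_mem_sq (p : ℕ) [Fact p.Prime] [CharP A p] {R : Ideal A}
    (hR : ∀ x ∈ R, x ^ p = 0) {ι : Type*} [Fintype ι] {v w : ι → A}
    (hv : ∀ i, v i ∈ R) (hvw : ∀ i, w i - v i ∈ R ^ 2)
    (h : finrank k M = p ^ Fintype.card ι *
      finrank k (M ⧸ (Ideal.span (Set.range v) • ⊤ : Submodule A M))) :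
    finrank k M = p ^ Fintype.card ι *
      finrank k (M ⧸ (Ideal.span (Set.range w) • ⊤ : Submodule A M)) := by
  classical
  have hw : ∀ i, w i ∈ R := fun i => by
    have := R.add_mem (Ideal.pow_le_self two_ne_zero (hvw i)) (hv i)
    rwa [sub_add_cancel] at this
  have key : ∀ s : Finset ι, finrank k M = p ^ Fintype.card ι *
      finrank k (M ⧸ (Ideal.span (Set.range (s.piecewise w v)) • ⊤ : Submodule A M)) := by
    intro s
    induction s using Finset.induction_on with
    | empty => rwa [Finset.piecewise_empty]
    | insert i s hi ih =>
      have h' := finrank_eq_pow_mul_update k M p hR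
        (fun j => s.piecewise_cases w v (· ∈ R) (hw j) (hv j)) i (hvw i) ih
      rwa [Finset.piecewise_eq_of_notMem _ _ _ hi, add_sub_cancel,
        ← Finset.piecewise_insert] at h'
  have h' := key Finset.univ
  rwa [Finset.piecewise_univ] at h'

end Coinvariants

theorem restrictScalars_span_smul_top_eq {k C A M : Type*} [Field k] [CommRing C] [Algebra k C]
    [CommRing A] [Algebra k A] [AddCommGroup M] [Module k M] [Module C M] [IsScalarTower k C M]
    [Module A M] [IsScalarTower k A M] (α : C →+* A) (hα : ∀ (c : C) (m : M), c • m = α c • m)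
    (s : Set C) :
    (Ideal.span s • ⊤ : Submodule C M).restrictScalars k =
      (Ideal.span (α '' s) • ⊤ : Submodule A M).restrictScalars k := by
  apply le_antisymm
  · intro x hx
    rw [Submodule.restrictScalars_mem] at hx ⊢
    induction hx using Submodule.smul_induction_on' with
    | smul c hc m hm =>
      rw [hα]
      refine Submodule.smul_mem_smul ?_ Submodule.mem_top
      rw [← Ideal.map_span]
      exact Ideal.mem_map_of_mem α hc
    | add x _ y _ hx hy => exact add_mem hx hy
  · intro x hx
    rw [Submodule.restrictScalars_mem] at hx ⊢
    induction hx using Submodule.smul_induction_on' with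
    | smul a ha m hm =>
      clear hm
      induction ha using Submodule.span_induction generalizing m with
      | mem a ha =>
        obtain ⟨c, hc, rfl⟩ := ha
        rw [← hα]
        exact Submodule.smul_mem_smul (Ideal.subset_span hc) Submodule.mem_top
      | zero => simp
      | add a b _ _ ha hb =>
        rw [add_smul]
        exact add_mem (ha m) (hb m)
      | smul b a _ ha =>
        rw [smul_eq_mul, mul_comm, mul_smul]
        exact ha (b • m)
    | add x _ y _ hx hy => exact add_mem hx hy

section TruncAlg

open Module

variable (k : Type*) [Field k] (n p : ℕ)

/-- The coefficients of a polynomial at the monomials with all exponents less than `p`. -/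
def truncCoeff : MvPolynomial (Fin n) k →ₗ[k] ((Fin n → Fin p) → k) :=
  LinearMap.pi fun d => MvPolynomial.lcoeff k (Finsupp.equivFunOnFinite.symm fun i => (d i : ℕ))

theorem truncCoeff_apply (f : MvPolynomial (Fin n) k) (d : Fin n → Fin p) :
    truncCoeff k n p f d =
      MvPolynomial.coeff (Finsupp.equivFunOnFinite.symm fun i => (d i : ℕ)) f := rfl

theorem truncCoeff_surjective : Function.Surjective (truncCoeff k n p) := by
  intro g
  refine ⟨∑ d, MvPolynomial.monomial (Finsupp.equivFunOnFinite.symm fun i => (d i : ℕ)) (g d), ?_⟩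
  ext d
  rw [truncCoeff_apply, MvPolynomial.coeff_sum, Finset.sum_eq_single d]
  · simp
  · intro d' _ hd'
    rw [MvPolynomial.coeff_monomial, if_neg]
    intro h
    apply hd'
    ext i
    exact congrFun (Finsupp.equivFunOnFinite.symm.injective h) i
  · simp

theorem mem_truncIdeal_iff (f : MvPolynomial (Fin n) k) :
    f ∈ truncIdeal k n p ↔ ∀ d ∈ f.support, ∃ i, p ≤ d i := by
  have h : (Set.range fun i : Fin n => (MvPolynomial.X i : MvPolynomial (Fin n) k) ^ p) =
      (fun d => MvPolynomial.monomial d (1 : k)) '' Set.range fun i => Finsupp.single i p := by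
    rw [← Set.range_comp]
    congr 1
    ext1 i
    exact MvPolynomial.X_pow_eq_monomial
  rw [truncIdeal, h, MvPolynomial.mem_ideal_span_monomial_image]
  simp

theorem ker_truncCoeff :
    LinearMap.ker (truncCoeff k n p) = (truncIdeal k n p).restrictScalars k := by
  ext f
  rw [LinearMap.mem_ker, Submodule.restrictScalars_mem, mem_truncIdeal_iff]
  constructor
  · intro h d hd
    by_contra! hlt
    apply MvPolynomial.mem_support_iff.1 hd
    have h' := congrFun h fun i => ⟨d i, hlt i⟩
    rw [truncCoeff_apply, Pi.zero_apply] at h'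
    convert h'
    ext i
    simp
  · intro h
    ext d
    rw [truncCoeff_apply]
    by_contra hne
    obtain ⟨i, hi⟩ := h _ (MvPolynomial.mem_support_iff.2 hne)
    exact absurd (d i).2 (not_lt.2 hi)

/-- Coordinates on `TruncAlg k n p` with respect to the monomial basis. -/
def truncAlgEquiv : TruncAlg k n p ≃ₗ[k] ((Fin n → Fin p) → k) :=
  (Submodule.Quotient.restrictScalarsEquiv k (truncIdeal k n p)).symm ≪≫ₗ
    Submodule.quotEquivOfEq _ _ (ker_truncCoeff k n p).symm ≪≫ₗ
    (truncCoeff k n p).quotKerEquivOfSurjective (truncCoeff_surjective k n p)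

instance : FiniteDimensional k (TruncAlg k n p) :=
  Module.Finite.equiv (truncAlgEquiv k n p).symm

theorem finrank_truncAlg : finrank k (TruncAlg k n p) = p ^ n := by
  rw [(truncAlgEquiv k n p).finrank_eq]
  simp

variable {k n p}

theorem xGen_pow (i : Fin n) : xGen k n p i ^ p = 0 := by
  rw [xGen, ← map_pow, Ideal.Quotient.eq_zero_iff_mem]
  exact Ideal.subset_span ⟨i, rfl⟩

theorem charP_truncAlg [hp : Fact p.Prime] [CharP k p] : CharP (TruncAlg k n p) p := by
  have : Nontrivial (TruncAlg k n p) :=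
    nontrivial_of_finrank_pos (R := k) (by rw [finrank_truncAlg]; exact pow_pos hp.out.pos n)
  exact charP_of_injective_algebraMap (algebraMap k (TruncAlg k n p)).injective p

theorem pow_eq_zero_of_mem_radIdeal [Fact p.Prime] [CharP k p] {x : TruncAlg k n p}
    (hx : x ∈ radIdeal k n p) : x ^ p = 0 := by
  have := charP_truncAlg (k := k) (n := n) (p := p)
  induction hx using Submodule.span_induction with
  | mem x hx =>
    obtain ⟨i, rfl⟩ := hx
    exact xGen_pow i
  | zero => exact zero_pow (Fact.out : p.Prime).ne_zero
  | add x y _ _ hx hy => rw [add_pow_char, hx, hy, add_zero]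
  | smul a x _ hx => rw [smul_eq_mul, mul_pow, hx, mul_zero]

theorem radIdeal_le_jacobson : radIdeal k n p ≤ Ideal.jacobson ⊥ := by
  refine le_trans (Ideal.span_le.2 ?_) Ideal.radical_le_jacobson
  rintro _ ⟨i, rfl⟩
  exact ⟨p, by rw [xGen_pow]; exact zero_mem _⟩

theorem exists_sub_algebraMap_mem_radIdeal (c : TruncAlg k n p) :
    ∃ x : k, c - algebraMap k (TruncAlg k n p) x ∈ radIdeal k n p := by
  obtain ⟨f, rfl⟩ := Ideal.Quotient.mk_surjective c
  induction f using MvPolynomial.induction_on with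
  | C a =>
    have h : Ideal.Quotient.mk (truncIdeal k n p) (MvPolynomial.C a) =
        algebraMap k (TruncAlg k n p) a := rfl
    exact ⟨a, by rw [h, sub_self]; exact zero_mem _⟩
  | add f g hf hg =>
    obtain ⟨x, hx⟩ := hf
    obtain ⟨y, hy⟩ := hg
    refine ⟨x + y, ?_⟩
    rw [map_add, map_add, add_sub_add_comm]
    exact add_mem hx hy
  | mul_X f i _ =>
    refine ⟨0, ?_⟩
    rw [map_zero, sub_zero, map_mul]
    exact Ideal.mul_mem_left _ _ (Ideal.subset_span ⟨i, rfl⟩)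

variable {M : Type*} [AddCommGroup M] [Module k M] [Module (TruncAlg k n p) M]
  [IsScalarTower k (TruncAlg k n p) M]

theorem span_mkQ_eq_top {s : Set M} (hs : Submodule.span (TruncAlg k n p) s = ⊤) :
    Submodule.span k
      ((radIdeal k n p • ⊤ : Submodule (TruncAlg k n p) M).mkQ '' s) = ⊤ := by
  let I := radIdeal k n p
  rw [eq_top_iff]
  intro q _
  obtain ⟨m, rfl⟩ := (I • ⊤ : Submodule (TruncAlg k n p) M).mkQ_surjective q
  have hm : m ∈ Submodule.span (TruncAlg k n p) s := hs ▸ Submodule.mem_top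
  induction hm using Submodule.span_induction with
  | mem m hm => exact Submodule.subset_span ⟨m, hm, rfl⟩
  | zero => rw [map_zero]; exact zero_mem _
  | add x y _ _ hx hy => rw [map_add]; exact add_mem (hx trivial) (hy trivial)
  | smul c m _ hm =>
    obtain ⟨x, hx⟩ := exists_sub_algebraMap_mem_radIdeal c
    have h : (I • ⊤ : Submodule (TruncAlg k n p) M).mkQ (c • m) =
        x • (I • ⊤ : Submodule (TruncAlg k n p) M).mkQ m := by
      rw [← algebraMap_smul (TruncAlg k n p) x, ← map_smul, ← sub_eq_zero, ← map_sub, ← sub_smul]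
      exact (Submodule.Quotient.mk_eq_zero _).2 (Submodule.smul_mem_smul hx Submodule.mem_top)
    rw [h]
    exact Submodule.smul_mem _ _ (hm trivial)

theorem free_iff_finrank_eq [FiniteDimensional k M] (hp : 0 < p) :
    Module.Free (TruncAlg k n p) M ↔ finrank k M = p ^ n *
      finrank k (M ⧸ (radIdeal k n p • ⊤ : Submodule (TruncAlg k n p) M)) := by
  have hfin : Module.Finite (TruncAlg k n p) M := Module.Finite.of_restrictScalars_finite k _ M
  have : Nontrivial (TruncAlg k n p) :=
    nontrivial_of_finrank_pos (R := k) (by rw [finrank_truncAlg]; exact pow_pos hp n)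
  let P := (radIdeal k n p • ⊤ : Submodule (TruncAlg k n p) M)
  constructor
  · intro hfree
    apply le_antisymm
    · have h := finrank_le_pow_card_mul (k := k) (M := M) (v := xGen k n p) Finset.univ
        fun i _ => xGen_pow i
      rwa [Finset.coe_univ, Set.image_univ, Finset.card_univ, Fintype.card_fin] at h
    · rw [← finrank_mul_finrank k (TruncAlg k n p) M, finrank_truncAlg]
      apply Nat.mul_le_mul_left
      let b := Module.finBasis (TruncAlg k n p) M
      have h := span_mkQ_eq_top (k := k) b.span_eq
      rw [← Set.range_comp] at h
      have h' := finrank_range_le_card (R := k) (P.mkQ ∘ b)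
      rwa [Set.finrank, h, finrank_top, Fintype.card_fin] at h'
  · intro h
    let b := Module.finBasis k (M ⧸ P)
    choose m hm using fun i => P.mkQ_surjective (b i)
    let Φ := Fintype.linearCombination (TruncAlg k n p) m
    have hspan : Submodule.span (TruncAlg k n p) (Set.range m) = ⊤ := by
      refine top_le_iff.1 (Submodule.le_of_le_smul_of_le_jacobson_bot hfin.fg_top
        radIdeal_le_jacobson fun x _ => ?_)
      have hx : P.mkQ (∑ i, b.repr (P.mkQ x) i • m i) = P.mkQ x := by
        rw [map_sum]
        conv_rhs => rw [← b.sum_repr (P.mkQ x)]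
        refine Finset.sum_congr rfl fun i _ => ?_
        rw [← algebraMap_smul (TruncAlg k n p), map_smul, hm, algebraMap_smul]
      rw [← sub_eq_zero, ← map_sub, Submodule.mkQ_apply, Submodule.Quotient.mk_eq_zero] at hx
      rw [← sub_sub_cancel (∑ i, b.repr (P.mkQ x) i • m i) x]
      refine sub_mem (Submodule.mem_sup_left (Submodule.sum_mem _ fun i _ => ?_))
        (Submodule.mem_sup_right hx)
      exact Submodule.smul_of_tower_mem _ _ (Submodule.subset_span ⟨i, rfl⟩)
    have hsurj : Function.Surjective Φ :=
      (span_range_eq_top_iff_surjective_fintypeLinearCombination ..).1 hspan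
    have hdim : finrank k (Fin (finrank k (M ⧸ P)) → TruncAlg k n p) = finrank k M := by
      rw [finrank_pi_fintype, h]
      simp [finrank_truncAlg, P, mul_comm]
    have hinj : Function.Injective Φ :=
      (LinearMap.injective_iff_surjective_of_finrank_eq_finrank
        (f := Φ.restrictScalars k) hdim).2 hsurj
    exact Module.Free.of_equiv (LinearEquiv.ofBijective Φ ⟨hinj, hsurj⟩)

end TruncAlg

theorem isFreeVia_iff_finrank_eq {k A M : Type*} [Field k] [CommRing A] [Algebra k A]
    [AddCommGroup M] [Module k M] [Module A M] [IsScalarTower k A M] [FiniteDimensional k M]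
    {p r : ℕ} (hp : 0 < p) (α : TruncAlg k r p →ₐ[k] A) :
    IsFreeVia α.toRingHom M ↔ Module.finrank k M = p ^ r * Module.finrank k
      (M ⧸ (Ideal.span (Set.range fun i => α (xGen k r p i)) • ⊤ : Submodule A M)) := by
  let _ : Module (TruncAlg k r p) M := Module.compHom M α.toRingHom
  have hsmul : ∀ (c : TruncAlg k r p) (m : M), c • m = α.toRingHom c • m := fun _ _ => rfl
  have : IsScalarTower k (TruncAlg k r p) M := ⟨fun x c m => by
    rw [hsmul, hsmul]
    simp⟩
  have hS := restrictScalars_span_smul_top_eq (k := k) α.toRingHom hsmul (Set.range (xGen k r p))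
  rw [← Set.range_comp] at hS
  have hq : Module.finrank k (M ⧸ (radIdeal k r p • ⊤ : Submodule (TruncAlg k r p) M)) =
      Module.finrank k
        (M ⧸ (Ideal.span (Set.range fun i => α (xGen k r p i)) • ⊤ : Submodule A M)) :=
    ((Submodule.Quotient.restrictScalarsEquiv k _).symm ≪≫ₗ Submodule.quotEquivOfEq _ _ hS ≪≫ₗ
      Submodule.Quotient.restrictScalarsEquiv k _).finrank_eq
  rw [← hq]
  exact free_iff_finrank_eq hp

/-- Independence of the `r`-rank variety of the choice of splitting: with `ψ : V → W`
the canonical isomorphism (`ψ(v) − v ∈ Rad²(A)`), for every `r`-dimensional subspace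
`U ⊆ V`, the restriction `α_U^*(M)` is free over `C` iff `α_{ψ(U)}^*(M)` is. -/
theorem statement10 {k : Type*} [Field k] [IsAlgClosed k] (p n r : ℕ) [Fact p.Prime]
    [CharP k p]
    (V W : Submodule k (TruncAlg k n p))
    (hV1 : V ⊓ Submodule.restrictScalars k ((radIdeal k n p) ^ 2 : Ideal (TruncAlg k n p)) = ⊥)
    (hV2 : V ⊔ Submodule.restrictScalars k ((radIdeal k n p) ^ 2 : Ideal (TruncAlg k n p)) =
      Submodule.restrictScalars k (radIdeal k n p))
    (hW1 : W ⊓ Submodule.restrictScalars k ((radIdeal k n p) ^ 2 : Ideal (TruncAlg k n p)) = ⊥)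
    (hW2 : W ⊔ Submodule.restrictScalars k ((radIdeal k n p) ^ 2 : Ideal (TruncAlg k n p)) =
      Submodule.restrictScalars k (radIdeal k n p))
    (ψ : V ≃ₗ[k] W)
    (hψ : ∀ v : V, ((ψ v : TruncAlg k n p) - (v : TruncAlg k n p)) ∈
      ((radIdeal k n p) ^ 2 : Ideal (TruncAlg k n p)))
    (M : Type*) [AddCommGroup M] [Module k M] [Module (TruncAlg k n p) M]
    [IsScalarTower k (TruncAlg k n p) M] [FiniteDimensional k M]
    (u : Fin r → TruncAlg k n p) (hu : ∀ i, u i ∈ V) (hind : LinearIndependent k u)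
    (α β : TruncAlg k r p →ₐ[k] TruncAlg k n p)
    (hα : ∀ i, α (xGen k r p i) = u i)
    (hβ : ∀ i, β (xGen k r p i) = (ψ ⟨u i, hu i⟩ : TruncAlg k n p)) :
    IsFreeVia α.toRingHom M ↔ IsFreeVia β.toRingHom M := by
  have := charP_truncAlg (k := k) (n := n) (p := p)
  have hp := (Fact.out : p.Prime).pos
  have hVR : ∀ v ∈ V, v ∈ radIdeal k n p := fun v hv =>
    (hV2.le (Submodule.mem_sup_left hv) : v ∈ (radIdeal k n p).restrictScalars k)
  have hWR : ∀ w ∈ W, w ∈ radIdeal k n p := fun w hw =>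
    (hW2.le (Submodule.mem_sup_left hw) : w ∈ (radIdeal k n p).restrictScalars k)
  rw [isFreeVia_iff_finrank_eq hp, isFreeVia_iff_finrank_eq hp, funext hα, funext hβ]
  have hR := fun x => pow_eq_zero_of_mem_radIdeal (k := k) (n := n) (p := p) (x := x)
  have key := fun v w hv hvw => finrank_eq_pow_mul_of_sub_mem_sq k M p hR (ι := Fin r) (v := v)
    (w := w) hv hvw
  rw [Fintype.card_fin] at key
  constructor
  · exact key _ _ (fun i => hVR _ (hu i)) fun i => hψ _
  · refine key _ _ (fun i => hWR _ (ψ _).2) fun i => ?_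
    rw [← neg_sub]
    exact neg_mem (hψ ⟨u i, hu i⟩)
end
end

section
/- Let V = span_k(x₁,…,x_n) ⊆ A and let 0 ≤ i < j be integers. Set M = Rad^i(A)/Rad^j(A), with its natural A-module structure. Then M has constant r-radical type and constant r-socle type for every 1 ≤ r ≤ n: for any two r-dimensional subspaces U, U′ ⊆ V and every ℓ ≥ 1, dim_k Rad^ℓ_U(M) = dim_k Rad^ℓ_{U′}(M) and dim_k Soc^ℓ_U(M) = dim_k Soc^ℓ_{U′}(M). -/
open scoped TensorProduct

set_option synthInstance.maxHeartbeats 1000000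
set_option maxHeartbeats 1000000

noncomputable section

/-- The subquotient `Rad^i(A)/Rad^j(A)` as an `A`-module. -/
abbrev RadQuot (k : Type*) [Field k] (n p i j : ℕ) : Type _ :=
  ↥(((radIdeal k n p) ^ i : Ideal (TruncAlg k n p)) :
      Submodule (TruncAlg k n p) (TruncAlg k n p)) ⧸
    (Submodule.comap ((radIdeal k n p) ^ i : Ideal (TruncAlg k n p)).subtype
      ((radIdeal k n p) ^ j : Ideal (TruncAlg k n p)))

/-- Two subspaces of the same dimension of a finite-dimensional space are exchanged by a linear
automorphism. -/
theorem exists_linearEquiv_map_eq_of_finrank_eq {k V : Type*} [Field k] [AddCommGroup V]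
    [Module k V] [FiniteDimensional k V] (U U' : Submodule k V)
    (h : Module.finrank k U = Module.finrank k U') :
    ∃ g : V ≃ₗ[k] V, U.map (g : V →ₗ[k] V) = U' := by
  obtain ⟨W, hW⟩ := U.exists_isCompl
  obtain ⟨W', hW'⟩ := U'.exists_isCompl
  have hWW : Module.finrank k W = Module.finrank k W' := by
    have h1 := Submodule.finrank_add_eq_of_isCompl hW
    have h2 := Submodule.finrank_add_eq_of_isCompl hW'
    omega
  let e := LinearEquiv.ofFinrankEq U U' h
  let f := LinearEquiv.ofFinrankEq W W' hWW
  let g : V ≃ₗ[k] V := (Submodule.prodEquivOfIsCompl U W hW).symm ≪≫ₗ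
    (LinearEquiv.prodCongr e f) ≪≫ₗ Submodule.prodEquivOfIsCompl U' W' hW'
  have hg (u : U) : g u = e u := by simp [g]
  refine ⟨g, Submodule.eq_of_le_of_finrank_eq ?_ ?_⟩
  · rintro _ ⟨u, hu, rfl⟩
    exact (hg ⟨u, hu⟩).symm ▸ (e ⟨u, hu⟩).2
  · rw [LinearEquiv.finrank_map_eq, h]

theorem xGen_mem_xSpan (k : Type*) [Field k] (n p : ℕ) (i : Fin n) :
    xGen k n p i ∈ xSpan k n p :=
  Submodule.subset_span ⟨i, rfl⟩

theorem xSpan_le_radIdeal {k : Type*} [Field k] {n p : ℕ} {v : TruncAlg k n p}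
    (hv : v ∈ xSpan k n p) : v ∈ radIdeal k n p :=
  Submodule.span_le_restrictScalars k (TruncAlg k n p) _ hv

theorem pow_eq_zero_of_mem_xSpan {k : Type*} [Field k] {n p : ℕ} [Fact p.Prime] [CharP k p]
    {v : TruncAlg k n p} (hv : v ∈ xSpan k n p) : v ^ p = 0 := by
  obtain ⟨c, rfl⟩ := (Submodule.mem_span_range_iff_exists_fun k).1 hv
  have : ∑ i, c i • xGen k n p i =
      Ideal.Quotient.mk (truncIdeal k n p) (∑ i, c i • MvPolynomial.X i) := by
    rw [map_sum]
    rfl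
  rw [this, ← map_pow, Ideal.Quotient.eq_zero_iff_mem, sum_pow_char]
  refine Ideal.sum_mem _ fun i _ => ?_
  rw [smul_pow, MvPolynomial.smul_eq_C_mul]
  exact Ideal.mul_mem_left _ _ (Ideal.subset_span ⟨i, rfl⟩)

/-- The algebra endomorphism extending a linear endomorphism of the space of linear forms. -/
def algHomOfXSpan {k : Type*} [Field k] {n p : ℕ} [Fact p.Prime] [CharP k p]
    (g : xSpan k n p →ₗ[k] xSpan k n p) : TruncAlg k n p →ₐ[k] TruncAlg k n p :=
  Ideal.Quotient.liftₐ (truncIdeal k n p)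
    (MvPolynomial.aeval fun i => (g ⟨xGen k n p i, xGen_mem_xSpan k n p i⟩ : TruncAlg k n p))
    (fun a ha => by
      have : truncIdeal k n p ≤ RingHom.ker (MvPolynomial.aeval (R := k) fun i =>
          (g ⟨xGen k n p i, xGen_mem_xSpan k n p i⟩ : TruncAlg k n p)) := by
        refine Ideal.span_le.2 ?_
        rintro _ ⟨i, rfl⟩
        simp [RingHom.mem_ker, pow_eq_zero_of_mem_xSpan (g _).2]
      exact this ha)

theorem algHomOfXSpan_apply {k : Type*} [Field k] {n p : ℕ} [Fact p.Prime] [CharP k p]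
    (g : xSpan k n p →ₗ[k] xSpan k n p) (v : xSpan k n p) :
    algHomOfXSpan g v = g v := by
  obtain ⟨v, hv⟩ := v
  induction hv using Submodule.span_induction with
  | mem x hx =>
    obtain ⟨i, rfl⟩ := hx
    exact MvPolynomial.aeval_X _ i
  | zero => exact (map_zero _).trans (congrArg Subtype.val (map_zero g)).symm
  | add x y hx hy ihx ihy =>
    exact (map_add _ x y).trans ((congrArg₂ _ ihx ihy).trans
      (congrArg Subtype.val (map_add g ⟨x, hx⟩ ⟨y, hy⟩)).symm)
  | smul c x hx ih =>
    exact (map_smul _ c x).trans ((congrArg _ ih).trans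
      (congrArg Subtype.val (map_smul g c ⟨x, hx⟩)).symm)

theorem algHom_truncAlg_ext {k B : Type*} [Field k] [Semiring B] [Algebra k B] {n p : ℕ}
    {f g : TruncAlg k n p →ₐ[k] B} (h : ∀ v ∈ xSpan k n p, f v = g v) : f = g :=
  Ideal.Quotient.algHom_ext _ <| MvPolynomial.algHom_ext fun i => h _ (xGen_mem_xSpan k n p i)

/-- The algebra automorphism extending a linear automorphism of the space of linear forms. -/
def algEquivOfXSpan {k : Type*} [Field k] {n p : ℕ} [Fact p.Prime] [CharP k p]
    (g : xSpan k n p ≃ₗ[k] xSpan k n p) : TruncAlg k n p ≃ₐ[k] TruncAlg k n p :=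
  AlgEquiv.ofAlgHom (algHomOfXSpan g.toLinearMap) (algHomOfXSpan g.symm.toLinearMap)
    (algHom_truncAlg_ext fun v hv => by
      have h1 := algHomOfXSpan_apply g.symm.toLinearMap ⟨v, hv⟩
      have h2 := algHomOfXSpan_apply g.toLinearMap (g.symm ⟨v, hv⟩)
      simp_all)
    (algHom_truncAlg_ext fun v hv => by
      have h1 := algHomOfXSpan_apply g.toLinearMap ⟨v, hv⟩
      have h2 := algHomOfXSpan_apply g.symm.toLinearMap (g ⟨v, hv⟩)
      simp_all)

theorem algEquivOfXSpan_apply {k : Type*} [Field k] {n p : ℕ} [Fact p.Prime] [CharP k p]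
    (g : xSpan k n p ≃ₗ[k] xSpan k n p) (v : xSpan k n p) :
    algEquivOfXSpan g v = g v :=
  algHomOfXSpan_apply g.toLinearMap v

theorem algEquivOfXSpan_mem_radIdeal_pow {k : Type*} [Field k] {n p : ℕ} [Fact p.Prime]
    [CharP k p] (g : xSpan k n p ≃ₗ[k] xSpan k n p) (i : ℕ) {a : TruncAlg k n p}
    (ha : a ∈ radIdeal k n p ^ i) : algEquivOfXSpan g a ∈ radIdeal k n p ^ i := by
  have h : (radIdeal k n p).map (algEquivOfXSpan g) ≤ radIdeal k n p := by
    rw [radIdeal, Ideal.map_span, Ideal.span_le]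
    rintro _ ⟨_, ⟨m, rfl⟩, rfl⟩
    have := algEquivOfXSpan_apply g ⟨xGen k n p m, xGen_mem_xSpan k n p m⟩
    exact this ▸ xSpan_le_radIdeal (g _).2
  have := Ideal.mem_map_of_mem (algEquivOfXSpan g) ha
  rw [Ideal.map_pow] at this
  exact Ideal.pow_right_mono h i this

/-- The semilinear endomorphism of `Rad^i(A)/Rad^j(A)` induced by `algEquivOfXSpan g`. -/
def radQuotMap {k : Type*} [Field k] {n p : ℕ} [Fact p.Prime] [CharP k p]
    (g : xSpan k n p ≃ₗ[k] xSpan k n p) (i j : ℕ) :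
    RadQuot k n p i j →ₛₗ[(algEquivOfXSpan g : TruncAlg k n p →+* TruncAlg k n p)]
      RadQuot k n p i j :=
  Submodule.mapQ _ _
    { toFun := fun x => ⟨algEquivOfXSpan g x, algEquivOfXSpan_mem_radIdeal_pow g i x.2⟩
      map_add' := fun _ _ => Subtype.ext (map_add _ _ _)
      map_smul' := fun _ _ => Subtype.ext (map_mul _ _ _) }
    (fun _ hx => algEquivOfXSpan_mem_radIdeal_pow g j hx)

theorem radQuotMap_symm_apply {k : Type*} [Field k] {n p : ℕ} [Fact p.Prime] [CharP k p]
    (g : xSpan k n p ≃ₗ[k] xSpan k n p) (i j : ℕ) (m : RadQuot k n p i j) :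
    radQuotMap g.symm i j (radQuotMap g i j m) = m := by
  obtain ⟨x, rfl⟩ := Submodule.Quotient.mk_surjective _ m
  exact congrArg _ (Subtype.ext ((algEquivOfXSpan g).symm_apply_apply x))

/-- The linear automorphism of `Rad^i(A)/Rad^j(A)` induced by `algEquivOfXSpan g`. -/
def radQuotEquiv {k : Type*} [Field k] {n p : ℕ} [Fact p.Prime] [CharP k p]
    (g : xSpan k n p ≃ₗ[k] xSpan k n p) (i j : ℕ) :
    RadQuot k n p i j ≃ₗ[k] RadQuot k n p i j where
  toFun := radQuotMap g i j
  invFun := radQuotMap g.symm i j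
  left_inv := radQuotMap_symm_apply g i j
  right_inv := radQuotMap_symm_apply g.symm i j
  map_add' := map_add _
  map_smul' c m := by
    rw [← algebraMap_smul (TruncAlg k n p) c m, LinearMap.map_smulₛₗ]
    exact (congrArg (· • _) ((algEquivOfXSpan g).commutes c)).trans (algebraMap_smul _ c _)

section Twist

variable {k A M : Type*} [Field k] [CommRing A] [AddCommGroup M] [Module k M] [Module A M]
  [SMulCommClass k A M] {φ : A ≃+* A} {e : M ≃ₗ[k] M} {U U' : Set A}

theorem map_radPow_le (he : ∀ (a : A) (m : M), e (a • m) = φ a • e m)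
    (h : ∀ u ∈ U, φ u ∈ U') (l : ℕ) :
    (radPow k A M U l).map (e : M →ₗ[k] M) ≤ radPow k A M U' l := by
  rw [Submodule.map_le_iff_le_comap]
  refine iSup₂_le fun u hu => ?_
  rintro _ ⟨m, rfl⟩
  refine Submodule.mem_iSup_of_mem (fun t => φ (u t))
    (Submodule.mem_iSup_of_mem (fun t => h _ (hu t)) ⟨e m, ?_⟩)
  simp [smulLinear, he]

theorem map_socPow_le (he : ∀ (a : A) (m : M), e (a • m) = φ a • e m)
    (h : ∀ u ∈ U', φ.symm u ∈ U) (l : ℕ) :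
    (socPow k A M U l).map (e : M →ₗ[k] M) ≤ socPow k A M U' l := by
  rintro _ ⟨m, hm, rfl⟩
  simp only [socPow, Submodule.mem_iInf, SetLike.mem_coe] at hm ⊢
  intro u hu
  have h0 : (∏ t, φ.symm (u t)) • m = 0 := hm (fun t => φ.symm (u t)) fun t => h _ (hu t)
  have h1 := he (∏ t, φ.symm (u t)) m
  rw [h0] at h1
  simpa [smulLinear] using h1.symm

theorem finrank_radPow_socPow_eq (he : ∀ (a : A) (m : M), e (a • m) = φ a • e m)
    (h : ∀ u ∈ U, φ u ∈ U') (h' : ∀ u ∈ U', φ.symm u ∈ U) (l : ℕ) :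
    Module.finrank k (radPow k A M U l) = Module.finrank k (radPow k A M U' l) ∧
      Module.finrank k (socPow k A M U l) = Module.finrank k (socPow k A M U' l) := by
  have he' (a : A) (m : M) : e.symm (a • m) = φ.symm a • e.symm m := by
    rw [LinearEquiv.symm_apply_eq]
    simp [he]
  have key (S T : Submodule k M) (h1 : S.map (e : M →ₗ[k] M) ≤ T)
      (h2 : T.map (e.symm : M →ₗ[k] M) ≤ S) : Module.finrank k S = Module.finrank k T := by
    have : S.map (e : M →ₗ[k] M) = T :=
      le_antisymm h1 fun x hx => ⟨e.symm x, h2 ⟨x, hx, rfl⟩, e.apply_symm_apply x⟩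
    rw [← this, LinearEquiv.finrank_map_eq]
  exact ⟨key _ _ (map_radPow_le he h l) (map_radPow_le he' h' l),
    key _ _ (map_socPow_le he h' l) (map_socPow_le he' h l)⟩

end Twist

/-- `M = Rad^i(A)/Rad^j(A)` has constant `r`-radical type and constant `r`-socle type
for every `1 ≤ r ≤ n`: the dimensions of `Rad^ℓ_U(M)` and `Soc^ℓ_U(M)` are the same for
all `r`-dimensional subspaces `U ⊆ V = span_k(x₁,…,xₙ)`. -/
theorem statement12 {k : Type*} [Field k] [IsAlgClosed k] (p n : ℕ) [Fact p.Prime]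
    [CharP k p] (i j : ℕ) (hij : i < j) (r : ℕ) (hr : 1 ≤ r) (hrn : r ≤ n)
    (U U' : Submodule k (TruncAlg k n p))
    (hU : U ≤ xSpan k n p) (hU' : U' ≤ xSpan k n p)
    (hrkU : Module.finrank k U = r) (hrkU' : Module.finrank k U' = r)
    (ℓ : ℕ) (hℓ : 1 ≤ ℓ) :
    Module.finrank k
        ↥(radPow k (TruncAlg k n p) (RadQuot k n p i j) (U : Set (TruncAlg k n p)) ℓ) =
      Module.finrank k
        ↥(radPow k (TruncAlg k n p) (RadQuot k n p i j) (U' : Set (TruncAlg k n p)) ℓ) ∧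
    Module.finrank k
        ↥(socPow k (TruncAlg k n p) (RadQuot k n p i j) (U : Set (TruncAlg k n p)) ℓ) =
      Module.finrank k
        ↥(socPow k (TruncAlg k n p) (RadQuot k n p i j) (U' : Set (TruncAlg k n p)) ℓ) := by
  have : FiniteDimensional k (xSpan k n p) :=
    FiniteDimensional.span_of_finite k (Set.finite_range _)
  obtain ⟨g, hg⟩ := exists_linearEquiv_map_eq_of_finrank_eq
    (U.comap (xSpan k n p).subtype) (U'.comap (xSpan k n p).subtype) (by
      rw [(Submodule.comapSubtypeEquivOfLe hU).finrank_eq,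
        (Submodule.comapSubtypeEquivOfLe hU').finrank_eq, hrkU, hrkU'])
  refine finrank_radPow_socPow_eq (φ := (algEquivOfXSpan g).toRingEquiv)
    (e := radQuotEquiv g i j) (fun a m => (radQuotMap g i j).map_smulₛₗ a m)
    (fun u hu => ?_) (fun u hu => ?_) ℓ
  · have h : g ⟨u, hU hu⟩ ∈ U'.comap (xSpan k n p).subtype := hg ▸ ⟨⟨u, hU hu⟩, hu, rfl⟩
    have h1 := algEquivOfXSpan_apply g ⟨u, hU hu⟩
    exact (congrArg (· ∈ U') h1).mpr h
  · have h : (⟨u, hU' hu⟩ : xSpan k n p) ∈ U'.comap (xSpan k n p).subtype := hu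
    rw [← hg] at h
    obtain ⟨v, hv, hvu⟩ := h
    have h1 : algEquivOfXSpan g v = u :=
      (algEquivOfXSpan_apply g v).trans (congrArg Subtype.val hvu)
    have h2 : (algEquivOfXSpan g).symm u = v := (AlgEquiv.symm_apply_eq _).2 h1.symm
    exact (congrArg (· ∈ U) h2).mpr hv

end
end

section
/- Let k be a field, s > 1 an integer, and ζ ∈ k a primitive s-th root of unity. Let R be an associative k-algebra and let z₁,…,z_n ∈ R satisfy z_i z_j = ζ z_j z_i for all 1 ≤ i < j ≤ n. Then for all scalars a₁,…,a_n ∈ k: (a₁z₁ + a₂z₂ + ⋯ + a_n z_n)ˢ = a₁ˢ z₁ˢ + a₂ˢ z₂ˢ + ⋯ + a_nˢ z_nˢ. -/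
set_option synthInstance.maxHeartbeats 1000000
set_option maxHeartbeats 1000000

/-- The Gaussian binomial coefficient, evaluated at `q`. -/
def gaussBinom {A : Type*} [CommRing A] (q : A) : ℕ → ℕ → A
  | _, 0 => 1
  | 0, _ + 1 => 0
  | n + 1, k + 1 => gaussBinom q n k + q ^ (k + 1) * gaussBinom q n (k + 1)

namespace gaussBinom

variable {A : Type*} [CommRing A] (q : A)

@[simp]
theorem zero_right (n : ℕ) : gaussBinom q n 0 = 1 := by
  cases n <;> simp [gaussBinom]

@[simp]
theorem zero_succ (k : ℕ) : gaussBinom q 0 (k + 1) = 0 := by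
  simp [gaussBinom]

theorem succ_succ (n k : ℕ) :
    gaussBinom q (n + 1) (k + 1) =
      gaussBinom q n k + q ^ (k + 1) * gaussBinom q n (k + 1) := by
  simp [gaussBinom]

theorem eq_zero_of_lt {n k : ℕ} (h : n < k) : gaussBinom q n k = 0 := by
  induction n generalizing k with
  | zero => obtain ⟨k, rfl⟩ := Nat.exists_eq_succ_of_ne_zero h.ne'; simp
  | succ n ih =>
    obtain ⟨k, rfl⟩ := Nat.exists_eq_succ_of_ne_zero (Nat.ne_zero_of_lt h)
    rw [Nat.succ_eq_add_one, succ_succ, ih (by omega), ih (by omega), mul_zero, add_zero]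

@[simp]
theorem self (n : ℕ) : gaussBinom q n n = 1 := by
  induction n with
  | zero => simp
  | succ n ih => rw [succ_succ, ih, eq_zero_of_lt q n.lt_succ_self, mul_zero, add_zero]

/-- The absorption identity for Gaussian binomial coefficients. -/
theorem pow_sub_one_mul_succ_succ (n k : ℕ) :
    (q ^ (k + 1) - 1) * gaussBinom q (n + 1) (k + 1) =
      (q ^ (n + 1) - 1) * gaussBinom q n k := by
  induction n generalizing k with
  | zero => cases k <;> simp [succ_succ]
  | succ n ih =>
    cases k with
    | zero =>
      have h := ih 0
      rw [succ_succ]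
      simp only [zero_right] at h ⊢
      linear_combination q * h
    | succ k =>
      rw [succ_succ q (n + 1)]
      linear_combination q ^ (k + 2) * ih (k + 1) + q * ih k
        - q * (q ^ (n + 1) - 1) * succ_succ q n k

end gaussBinom

section QCommute

variable {A R : Type*} [CommRing A] [Ring R] [Algebra A R] {q : A} {x y : R}

theorem mul_pow_of_mul_eq_smul (h : x * y = q • (y * x)) (m : ℕ) :
    x * y ^ m = q ^ m • (y ^ m * x) := by
  induction m with
  | zero => simp
  | succ m ih =>
    rw [pow_succ, ← mul_assoc, ih, smul_mul_assoc, mul_assoc, h, mul_smul_comm, smul_smul,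
      ← pow_succ, mul_assoc]

/-- The noncommutative `q`-binomial theorem. -/
theorem add_pow_of_mul_eq_smul (h : x * y = q • (y * x)) (n : ℕ) :
    (x + y) ^ n =
      ∑ m ∈ Finset.range (n + 1), gaussBinom q n m • (y ^ m * x ^ (n - m)) := by
  induction n with
  | zero => simp
  | succ n ih =>
    have hx : x * ∑ m ∈ Finset.range (n + 1), gaussBinom q n m • (y ^ m * x ^ (n - m)) =
        ∑ m ∈ Finset.range (n + 2),
          (q ^ m * gaussBinom q n m) • (y ^ m * x ^ (n + 1 - m)) := by
      rw [Finset.sum_range_succ _ (n + 1), gaussBinom.eq_zero_of_lt q n.lt_succ_self, mul_zero,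
        zero_smul, add_zero, Finset.mul_sum]
      refine Finset.sum_congr rfl fun m hm => ?_
      rw [Nat.succ_sub (Finset.mem_range_succ_iff.mp hm), pow_succ', mul_smul_comm,
        ← mul_assoc, mul_pow_of_mul_eq_smul h, smul_mul_assoc, smul_smul, mul_assoc,
        mul_comm (q ^ m)]
    rw [pow_succ', ih, add_mul, hx, Finset.sum_range_succ', Finset.sum_range_succ' _ (n + 1),
      add_right_comm, Finset.mul_sum, ← Finset.sum_add_distrib]
    congr 1
    · refine Finset.sum_congr rfl fun m _ => ?_
      rw [gaussBinom.succ_succ, add_smul, add_comm, Nat.add_sub_add_right, mul_smul_comm,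
        ← mul_assoc, ← pow_succ']
    · simp

end QCommute

theorem IsPrimitiveRoot.gaussBinom_eq_zero {A : Type*} [CommRing A] [IsDomain A] {q : A}
    {s m : ℕ} (hq : IsPrimitiveRoot q s) (hm : m ≠ 0) (hms : m < s) :
    gaussBinom q s m = 0 := by
  obtain ⟨m, rfl⟩ := Nat.exists_eq_succ_of_ne_zero hm
  obtain ⟨s, rfl⟩ := Nat.exists_eq_succ_of_ne_zero (Nat.ne_zero_of_lt hms)
  have h := gaussBinom.pow_sub_one_mul_succ_succ q s m
  rw [hq.pow_eq_one, sub_self, zero_mul] at h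
  exact (mul_eq_zero.mp h).resolve_left
    (sub_ne_zero.mpr (hq.pow_ne_one_of_pos_of_lt m.succ_ne_zero hms))

theorem IsPrimitiveRoot.add_pow_of_mul_eq_smul {A R : Type*} [CommRing A] [IsDomain A] [Ring R]
    [Algebra A R] {q : A} {s : ℕ} (hq : IsPrimitiveRoot q s) (hs : s ≠ 0) {x y : R}
    (h : x * y = q • (y * x)) : (x + y) ^ s = x ^ s + y ^ s := by
  obtain ⟨s, rfl⟩ := Nat.exists_eq_succ_of_ne_zero hs
  rw [_root_.add_pow_of_mul_eq_smul h, Finset.sum_range_succ, Finset.sum_range_succ',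
    Finset.sum_eq_zero]
  · simp
  · intro m hm
    rw [hq.gaussBinom_eq_zero m.succ_ne_zero (by simpa using hm), zero_smul]

theorem IsPrimitiveRoot.sum_pow_of_mul_eq_smul {A R : Type*} [CommRing A] [IsDomain A] [Ring R]
    [Algebra A R] {q : A} {s : ℕ} (hq : IsPrimitiveRoot q s) (hs : s ≠ 0) {n : ℕ}
    {w : Fin n → R} (h : ∀ i j, i < j → w i * w j = q • (w j * w i)) :
    (∑ i, w i) ^ s = ∑ i, w i ^ s := by
  induction n with
  | zero => simp [hs]
  | succ n ih =>
    rw [Fin.sum_univ_succ, Fin.sum_univ_succ, hq.add_pow_of_mul_eq_smul hs,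
      ih fun i j hij => h _ _ (Fin.succ_lt_succ_iff.mpr hij)]
    rw [Finset.mul_sum, Finset.sum_mul, Finset.smul_sum]
    exact Finset.sum_congr rfl fun i _ => h _ _ i.succ_pos

/-- If `ζ ∈ k` is a primitive `s`-th root of unity and `z₁,…,zₙ` are `ζ`-commuting
elements of an associative `k`-algebra (`zᵢzⱼ = ζ zⱼzᵢ` for `i < j`), then
`(a₁z₁ + ⋯ + aₙzₙ)ˢ = a₁ˢz₁ˢ + ⋯ + aₙˢzₙˢ` for all scalars `aᵢ ∈ k`. -/
theorem statement15 {k : Type*} [Field k] (s : ℕ) (hs : 1 < s) (ζ : k)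
    (hζ : IsPrimitiveRoot ζ s)
    (R : Type*) [Ring R] [Algebra k R] (n : ℕ) (z : Fin n → R)
    (hz : ∀ i j : Fin n, i < j → z i * z j = ζ • (z j * z i)) (a : Fin n → k) :
    (∑ i, a i • z i) ^ s = ∑ i, (a i) ^ s • (z i) ^ s := by
  simp_rw [← smul_pow]
  refine hζ.sum_pow_of_mul_eq_smul (by omega) fun i j hij => ?_
  rw [smul_mul_smul_comm, smul_mul_smul_comm, hz i j hij, smul_comm ζ, mul_comm (a i)]
end

section
/- Let k be an algebraically closed field and let n > r ≥ 1 be integers. Then there exists a nonzero homogeneous polynomial f ∈ k[X₀,…,X_n] such that f vanishes identically on some r-dimensional k-linear subspace of k^{n+1}, but f does not vanish identically on any (r+1)-dimensional k-linear subspace of k^{n+1}. (Equivalently, the projective hypersurface Z(f) ⊂ ℙⁿ contains a linear subspace of projective dimension r−1 but no linear subspace of projective dimension r.) -/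
set_option synthInstance.maxHeartbeats 1000000
set_option maxHeartbeats 1000000

/-- The form `∑_{i < j} x_i ^ (q - p ^ e(i,j)) * x_j ^ p ^ e(i,j)`, where `q = p ^ (m * m)` and
`e(i,j) = i * m + j`. -/
def frobeniusForm (p : ℕ) {m : ℕ} {R : Type*} [CommSemiring R] (x : Fin m → R) : R :=
  ∑ i : Fin m, ∑ j ∈ Finset.Ioi i,
    x i ^ (p ^ (m * m) - p ^ (i * m + j : ℕ)) * x j ^ p ^ (i * m + j : ℕ)

theorem exponent_lt {m : ℕ} (i j : Fin m) : (i * m + j : ℕ) < m * m := by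
  have := i.2
  have := j.2
  nlinarith

theorem pow_exponent_lt {p : ℕ} (hp : p.Prime) {m : ℕ} (i j : Fin m) :
    p ^ (i * m + j : ℕ) < p ^ (m * m) :=
  Nat.pow_lt_pow_right hp.one_lt (exponent_lt i j)

theorem map_frobeniusForm (p : ℕ) {m : ℕ} {R S : Type*} [CommSemiring R] [CommSemiring S]
    (φ : R →+* S) (x : Fin m → R) :
    φ (frobeniusForm p x) = frobeniusForm p (fun l => φ (x l)) := by
  simp [frobeniusForm]

theorem isHomogeneous_frobeniusForm {p : ℕ} (hp : p.Prime) {m : ℕ} {R σ : Type*} [CommSemiring R]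
    (h : Fin m → σ) :
    (frobeniusForm p (fun l => (MvPolynomial.X (h l) : MvPolynomial σ R))).IsHomogeneous
      (p ^ (m * m)) := by
  refine MvPolynomial.IsHomogeneous.sum _ _ _ fun i _ =>
    MvPolynomial.IsHomogeneous.sum _ _ _ fun j _ => ?_
  have hd := (MvPolynomial.isHomogeneous_X_pow (R := R) (h i)
    (p ^ (m * m) - p ^ (i * m + j : ℕ))).mul
    (MvPolynomial.isHomogeneous_X_pow (R := R) (h j) (p ^ (i * m + j : ℕ)))
  rwa [Nat.sub_add_cancel (pow_exponent_lt hp i j).le] at hd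

theorem frobeniusForm_eq_zero {p : ℕ} (hp : p.Prime) {m : ℕ} {R : Type*} [CommSemiring R]
    {x : Fin m → R} (hx : ∀ i j : Fin m, i < j → x j = 0) : frobeniusForm p x = 0 := by
  refine Finset.sum_eq_zero fun i _ => Finset.sum_eq_zero fun j hj => ?_
  rw [hx i j (Finset.mem_Ioi.mp hj), zero_pow (pow_ne_zero _ hp.ne_zero), mul_zero]

theorem coeff_pow_char_pow_eq_zero {p : ℕ} [hp : Fact p.Prime] {K : Type*} [Field K] [CharP K p]
    (f : Polynomial K) {e N : ℕ} (h : e < N) : (f ^ p ^ N).coeff (p ^ e) = 0 := by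
  rw [← Polynomial.map_iterateFrobenius_expand (p := p), Polynomial.coeff_map,
    Polynomial.coeff_expand (pow_pos hp.out.pos _), if_neg, map_zero]
  exact Nat.not_dvd_of_pos_of_lt (pow_pos hp.out.pos _) (Nat.pow_lt_pow_right hp.out.one_lt h)

theorem frobeniusForm_line_ne_zero {p : ℕ} [hp : Fact p.Prime] {K : Type*} [Field K] [CharP K p]
    {m : ℕ} (w z : Fin m → K) (i j : Fin m) (hij : i < j) (hwi : w i = 1) (hzi : z i = 0)
    (hzj : z j = 1) (hw : ∀ l < i, w l = 0) (hz : ∀ l < i, z l = 0) :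
    frobeniusForm p (fun l => Polynomial.C (w l) + Polynomial.X * Polynomial.C (z l)) ≠ 0 := by
  intro h0
  have hc := congrArg (fun f => Polynomial.coeff f (p ^ (i * m + j : ℕ))) h0
  simp only [frobeniusForm, Polynomial.finsetSum_coeff, Polynomial.coeff_zero] at hc
  rw [Finset.sum_eq_single i, Finset.sum_eq_single j] at hc
  · rw [hwi, hzi, hzj] at hc
    simp [add_pow_char_pow, ← Polynomial.C_pow, -map_pow, Polynomial.coeff_C, hp.out.ne_zero] at hc
  · intro l _ hl
    rw [hwi, hzi]
    have hne : ¬ p ^ (i * m + j : ℕ) = p ^ (i * m + l : ℕ) := fun h => by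
      have := Nat.pow_right_injective hp.out.two_le h
      exact hl (Fin.ext (by omega))
    simp [add_pow_char_pow, mul_pow, ← Polynomial.C_pow, -map_pow, Polynomial.coeff_C,
      hp.out.ne_zero, Polynomial.coeff_X_pow, hne]
  · intro h
    exact absurd (Finset.mem_Ioi.mpr hij) h
  · intro l _ hl
    refine Finset.sum_eq_zero fun t _ => ?_
    rcases lt_or_gt_of_ne hl with hl | hl
    · rw [hw l hl, hz l hl]
      have := pow_exponent_lt hp.out l t
      simp [zero_pow (Nat.sub_ne_zero_of_lt this)]
    · have hle : (i * m + j : ℕ) + 1 ≤ l * m := by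
        have := j.2
        have : (i : ℕ) + 1 ≤ l := hl
        nlinarith
      have hd : p ^ (l * m : ℕ) ∣ p ^ (m * m) - p ^ (l * m + t : ℕ) :=
        Nat.dvd_sub (pow_dvd_pow _ (Nat.mul_le_mul_right _ l.2.le)) (pow_dvd_pow _ (by omega))
      obtain ⟨c, hc⟩ := hd
      rw [hc, pow_add p, mul_comm _ c, mul_comm _ (p ^ (t : ℕ)), pow_mul _ c, pow_mul _ (p ^ (t : ℕ)),
        ← mul_pow]
      exact coeff_pow_char_pow_eq_zero _ hle
  · simp

theorem exists_valuationSubring_charP_residueField (k : Type*) [Field k] :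
    ∃ (p : ℕ) (B : ValuationSubring k), p.Prime ∧ CharP (IsLocalRing.ResidueField B) p := by
  suffices h : ∃ (p : ℕ) (B : ValuationSubring k), p.Prime ∧ (p : k) ∈ B.nonunits by
    obtain ⟨p, B, hp, hB⟩ := h
    refine ⟨p, B, hp, (CharP.charP_iff_prime_eq_zero hp).mpr ?_⟩
    have : (p : B) ∈ IsLocalRing.maximalIdeal B := by
      rw [← ValuationSubring.coe_mem_nonunits_iff]
      simpa using hB
    rw [← IsLocalRing.residue_eq_zero_iff] at this
    simpa using this
  obtain ⟨q, hq⟩ := CharP.exists k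
  rcases CharP.char_is_prime_or_zero k q with hp | rfl
  · exact ⟨q, ⊤, hp, by rw [CharP.cast_eq_zero]; exact zero_mem _⟩
  · have := CharP.charP_to_charZero k
    have hI : Ideal.span {(2 : (Int.castRingHom k).range)} ≠ ⊤ := by
      rw [Ne, Ideal.span_singleton_eq_top, isUnit_iff_exists_inv]
      rintro ⟨⟨_, a, rfl⟩, h⟩
      have h' : (2 : k) * (a : k) = 1 := congrArg Subtype.val h
      have : (2 : ℤ) * a = 1 := by exact_mod_cast h'
      omega
    obtain ⟨B, -, hB⟩ := Ideal.image_subset_nonunits_valuationSubring _ hI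
    exact ⟨2, B, Nat.prime_two, hB ⟨2, Ideal.subset_span rfl, rfl⟩⟩

theorem exists_integral_mem_of_ne_zero {k : Type*} [Field k] (B : ValuationSubring k) {m : ℕ}
    {V : Submodule k (Fin m → k)} {x : Fin m → k} (hx : x ∈ V) (hx0 : x ≠ 0) :
    ∃ z : Fin m → B, (fun l => (z l : k)) ∈ V ∧ (∃ j, z j = 1) ∧ ∀ i, x i = 0 → z i = 0 := by
  obtain ⟨j₀, hj₀⟩ := Function.ne_iff.mp hx0
  obtain ⟨j, -, hj⟩ :=
    Finset.exists_max_image Finset.univ (fun l => B.valuation (x l)) ⟨j₀, by simp⟩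
  have hj0 : x j ≠ 0 := fun h => by
    have := hj j₀ (by simp)
    rw [h, map_zero] at this
    exact hj₀ (by simpa using this)
  have hmem : ∀ l, (x j)⁻¹ * x l ∈ B := fun l => by
    rw [← ValuationSubring.valuation_le_one_iff, map_mul, map_inv₀, inv_mul_le_iff₀, mul_one]
    · exact hj l (by simp)
    · exact zero_lt_iff.mpr (by simpa using hj0)
  refine ⟨fun l => ⟨_, hmem l⟩, V.smul_mem (x j)⁻¹ hx, ⟨j, ?_⟩, fun i hi => ?_⟩
  · exact Subtype.ext (inv_mul_cancel₀ hj0)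
  · exact Subtype.ext (by simp [hi])

theorem exists_adapted_integral_pair {k : Type*} [Field k] (B : ValuationSubring k) {m : ℕ}
    {V : Submodule k (Fin m → k)} (hV : 2 ≤ Module.finrank k V) :
    ∃ (w z : Fin m → B) (i j : Fin m), (fun l => (w l : k)) ∈ V ∧ (fun l => (z l : k)) ∈ V ∧
      i < j ∧ w i = 1 ∧ z i = 0 ∧ z j = 1 ∧
      (∀ l < i, IsLocalRing.residue B (w l) = 0) ∧ ∀ l < i, IsLocalRing.residue B (z l) = 0 := by
  let P : Fin m → Prop := fun i => ∃ w : Fin m → B, (fun l => (w l : k)) ∈ V ∧ IsUnit (w i)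
  have hP : ∃ i, P i := by
    obtain ⟨x, hx, hx0⟩ := V.exists_mem_ne_zero_of_ne_bot (by rintro rfl; simp at hV)
    obtain ⟨w, hw, ⟨j, hj⟩, -⟩ := exists_integral_mem_of_ne_zero B hx hx0
    exact ⟨j, w, hw, hj ▸ isUnit_one⟩
  obtain ⟨i, ⟨w, hw, hu⟩, hmin⟩ := WellFounded.has_min (wellFounded_lt (α := Fin m)) {i | P i} hP
  have hres : ∀ y : Fin m → B, (fun l => (y l : k)) ∈ V → ∀ l < i,
      IsLocalRing.residue B (y l) = 0 := fun y hy l hl => by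
    rw [IsLocalRing.residue_eq_zero_iff, IsLocalRing.mem_maximalIdeal]
    exact fun h => hmin l ⟨y, hy, h⟩ hl
  obtain ⟨c, hc⟩ := isUnit_iff_exists_inv'.mp hu
  have hcw : (fun l => ((c * w l : B) : k)) ∈ V := V.smul_mem (c : k) hw
  have hker : LinearMap.ker ((LinearMap.proj (R := k) (φ := fun _ : Fin m => k) i) ∘ₗ V.subtype)
      ≠ ⊥ := LinearMap.ker_ne_bot_of_finrank_lt (by rw [Module.finrank_self]; omega)
  obtain ⟨x, hx, hx0⟩ := Submodule.exists_mem_ne_zero_of_ne_bot hker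
  obtain ⟨z, hz, ⟨j, hj⟩, hzi⟩ := exists_integral_mem_of_ne_zero B x.2 (by simpa using hx0)
  have hzi : z i = 0 := hzi i hx
  refine ⟨fun l => c * w l, z, i, j, hcw, hz, ?_, hc, hzi, hj, hres _ hcw, hres _ hz⟩
  refine lt_of_le_of_ne (le_of_not_gt fun h => ?_) fun h => ?_
  · simpa [hj] using hres z hz j h
  · subst h
    exact zero_ne_one (hzi.symm.trans hj)

theorem exists_mem_frobeniusForm_ne_zero {k : Type*} [Field k] [Infinite k] {p : ℕ} (hp : p.Prime)
    (B : ValuationSubring k) [CharP (IsLocalRing.ResidueField B) p] {m : ℕ}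
    {V : Submodule k (Fin m → k)} (hV : 2 ≤ Module.finrank k V) :
    ∃ v ∈ V, frobeniusForm p v ≠ 0 := by
  by_contra! h
  have := Fact.mk hp
  obtain ⟨w, z, i, j, hw, hz, hij, hwi, hzi, hzj, hw0, hz0⟩ := exists_adapted_integral_pair B hV
  have hB :
      frobeniusForm p (fun l => Polynomial.C (w l) + Polynomial.X * Polynomial.C (z l)) = 0 := by
    apply Polynomial.map_injective B.subtype B.subtype_injective
    rw [Polynomial.map_zero]
    refine Polynomial.funext fun t => ?_
    rw [Polynomial.eval_map, ← Polynomial.coe_eval₂RingHom, map_frobeniusForm]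
    simpa [Pi.add_def, Pi.smul_def, mul_comm t] using h _ (V.add_mem hw (V.smul_mem t hz))
  apply frobeniusForm_line_ne_zero (p := p) (fun l => IsLocalRing.residue B (w l))
    (fun l => IsLocalRing.residue B (z l)) i j hij (by simp [hwi]) (by simp [hzi]) (by simp [hzj])
    hw0 hz0
  have := congrArg (Polynomial.mapRingHom (IsLocalRing.residue B)) hB
  rw [map_frobeniusForm, map_zero] at this
  simpa using this

theorem two_le_finrank_map_funLeft {k : Type*} [Field k] {s c : ℕ}
    (L : Submodule k (Fin (s + c) → k)) (hL : Module.finrank k L = s + 2) :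
    2 ≤ Module.finrank k (L.map (LinearMap.funLeft k k (Fin.natAdd s : Fin c → Fin (s + c)))) := by
  set π := LinearMap.funLeft k k (Fin.natAdd s : Fin c → Fin (s + c))
  have hπ : Function.Surjective π :=
    LinearMap.funLeft_surjective_of_injective k k _ (Fin.natAdd_injective c s)
  have h1 := π.finrank_range_add_finrank_ker
  rw [LinearMap.range_eq_top.mpr hπ, finrank_top] at h1
  simp only [Module.finrank_fin_fun] at h1
  have h2 := (π.domRestrict L).finrank_range_add_finrank_ker
  rw [LinearMap.range_domRestrict, LinearMap.ker_domRestrict] at h2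
  have h3 : Module.finrank k ((LinearMap.ker π).comap L.subtype) ≤
      Module.finrank k (LinearMap.ker π) := by
    rw [← Submodule.finrank_map_subtype_eq]
    exact Submodule.finrank_mono (Submodule.map_comap_le _ _)
  omega

/-- For `n > r ≥ 1` and `k` algebraically closed, there is a nonzero homogeneous
polynomial `f ∈ k[X₀,…,Xₙ]` vanishing identically on some `r`-dimensional linear
subspace of `k^{n+1}` but on no `(r+1)`-dimensional linear subspace. -/
theorem statement17 {k : Type*} [Field k] [IsAlgClosed k] (n r : ℕ)
    (hr : 1 ≤ r) (hrn : r < n) :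
    ∃ (f : MvPolynomial (Fin (n + 1)) k) (d : ℕ), f ≠ 0 ∧ f.IsHomogeneous d ∧
      (∃ L : Submodule k (Fin (n + 1) → k), Module.finrank k L = r ∧
        ∀ v ∈ L, MvPolynomial.eval v f = 0) ∧
      (∀ L' : Submodule k (Fin (n + 1) → k), Module.finrank k L' = r + 1 →
        ∃ v ∈ L', MvPolynomial.eval v f ≠ 0) := by
  obtain ⟨s, rfl⟩ : ∃ s, r = s + 1 := ⟨r - 1, by omega⟩
  obtain ⟨c, rfl⟩ : ∃ c, n = s + (c + 1) := ⟨n - s - 1, by omega⟩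
  obtain ⟨p, B, hp, hB⟩ := exists_valuationSubring_charP_residueField k
  have := IsAlgClosed.instInfinite (K := k)
  let h : Fin (c + 2) → Fin (s + (c + 1) + 1) := Fin.natAdd s
  let f : MvPolynomial (Fin (s + (c + 1) + 1)) k := frobeniusForm p (fun l => MvPolynomial.X (h l))
  have hf : ∀ v, MvPolynomial.eval v f = frobeniusForm p (fun l => v (h l)) := fun v => by
    simp [f, map_frobeniusForm]
  have hlarge : ∀ L' : Submodule k (Fin (s + (c + 1) + 1) → k),
      Module.finrank k L' = s + 1 + 1 → ∃ v ∈ L', MvPolynomial.eval v f ≠ 0 := fun L' hL' => by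
    obtain ⟨_, ⟨v, hv, rfl⟩, hv0⟩ :=
      exists_mem_frobeniusForm_ne_zero hp B (two_le_finrank_map_funLeft (c := c + 2) L' hL')
    exact ⟨v, hv, by rw [hf]; exact hv0⟩
  have hcoord : ∀ a, a ≤ s + (c + 1) + 1 →
      ∃ L : Submodule k (Fin (s + (c + 1) + 1) → k), Module.finrank k L = a ∧
        ∀ v ∈ L, ∀ l : Fin (s + (c + 1) + 1), a ≤ l → v l = 0 := fun a ha => by
    have hli := (Pi.basisFun k (Fin (s + (c + 1) + 1))).linearIndependent.comp
      (Fin.castLE ha) (Fin.castLE_injective ha)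
    refine ⟨_, (finrank_span_eq_card hli).trans (Fintype.card_fin a), fun v hv l hl => ?_⟩
    have hle : Submodule.span k (Set.range (Pi.basisFun k _ ∘ Fin.castLE ha)) ≤
        LinearMap.ker (LinearMap.proj (R := k) (φ := fun _ => k) l) := by
      rw [Submodule.span_le]
      rintro _ ⟨b, rfl⟩
      have : l ≠ Fin.castLE ha b := fun hb => by
        have := congrArg Fin.val hb
        simp at this
        omega
      simp [Pi.single_eq_of_ne this]
    exact hle hv
  refine ⟨f, p ^ ((c + 2) * (c + 2)), ?_, isHomogeneous_frobeniusForm hp h, ?_, hlarge⟩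
  · obtain ⟨L, hL, -⟩ := hcoord (s + 1 + 1) (by omega)
    obtain ⟨v, -, hv⟩ := hlarge L hL
    rintro hf0
    simp [hf0] at hv
  · obtain ⟨L, hL, hL0⟩ := hcoord (s + 1) (by omega)
    refine ⟨L, hL, fun v hv => ?_⟩
    rw [hf]
    refine frobeniusForm_eq_zero hp fun i j hij => hL0 v hv _ ?_
    have : (i : ℕ) < j := hij
    simp only [h, Fin.val_natAdd]
    omega
end

section
/- Let M be a finite-dimensional A-module. Let R = k[Y_{ij} : r+1 ≤ i ≤ n, 1 ≤ j ≤ r] be a polynomial ring, and for 1 ≤ j ≤ r define the R-linear operator θ_j on M ⊗_k R by θ_j(m ⊗ f) = x_j·m ⊗ f + Σ_{i=r+1}^n x_i·m ⊗ Y_{ij}f. (a) If there is an integer c such that dim_k Soc_U(M) = c for every r-dimensional subspace U ⊆ span_k(x₁,…,x_n) (i.e., M has constant r-Soc rank), then ⋂_{j=1}^r ker(θ_j) is a finitely generated projective R-module of constant rank c. (b) If there is an integer c′ such that dim_k Rad_U(M) = c′ for every r-dimensional subspace U ⊆ span_k(x₁,…,x_n) (i.e., M has constant r-Rad rank), then Σ_{j=1}^r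 im(θ_j) is a finitely generated projective R-module of constant rank c′. -/
open scoped TensorProduct

set_option synthInstance.maxHeartbeats 1000000
set_option maxHeartbeats 1000000

noncomputable section

/-- The local operator `θ_j` on `R ⊗_k M`, where `R = k[Y_{ij} : r+1 ≤ i ≤ n, 1 ≤ j ≤ r]`:
`θ_j(f ⊗ m) = f ⊗ x_j·m + Σ_{i=r+1}^n Y_{ij}f ⊗ x_i·m`. -/
def thetaOp (k : Type*) [Field k] (p n r : ℕ) (hrn : r ≤ n)
    (M : Type*) [AddCommGroup M] [Module k M] [Module (TruncAlg k n p) M]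
    [SMulCommClass k (TruncAlg k n p) M] (j : Fin r) :
    (MvPolynomial (Fin (n - r) × Fin r) k ⊗[k] M) →ₗ[MvPolynomial (Fin (n - r) × Fin r) k]
      (MvPolynomial (Fin (n - r) × Fin r) k ⊗[k] M) :=
  LinearMap.baseChange (MvPolynomial (Fin (n - r) × Fin r) k)
      (smulLinear k M (xGen k n p (Fin.castLE hrn j))) +
    ∑ i : Fin (n - r),
      (MvPolynomial.X (i, j) : MvPolynomial (Fin (n - r) × Fin r) k) •
        LinearMap.baseChange (MvPolynomial (Fin (n - r) × Fin r) k)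
          (smulLinear k M (xGen k n p ⟨r + i.val, by have := i.isLt; omega⟩))

open TensorProduct

/-- A finite module over a local domain whose generic rank equals the dimension of its closed fibre
is free. -/
theorem free_of_finrank_residueField_eq {S N : Type*} [CommRing S] [IsDomain S] [IsLocalRing S]
    [AddCommGroup N] [Module S N] [Module.Finite S N]
    (h : Module.finrank (IsLocalRing.ResidueField S) (IsLocalRing.ResidueField S ⊗[S] N) =
      Module.finrank S N) : Module.Free S N := by
  obtain ⟨n, g, b, hb⟩ : ∃ (n : ℕ) (g : Fin n → N)
      (b : Module.Basis (Fin n) (IsLocalRing.ResidueField S) (IsLocalRing.ResidueField S ⊗[S] N)),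
      ∀ i, 1 ⊗ₜ g i = b i := by
    let b := Module.finBasis (IsLocalRing.ResidueField S) (IsLocalRing.ResidueField S ⊗[S] N)
    have hs : Function.Surjective (TensorProduct.mk S (IsLocalRing.ResidueField S) N 1) :=
      TensorProduct.mk_surjective _ _ _ IsLocalRing.residue_surjective
    choose g hg using fun i => hs (b i)
    exact ⟨_, g, b, hg⟩
  have hn : Module.finrank S N = n := by
    rw [← h, Module.finrank_eq_card_basis b, Fintype.card_fin]
  have hsurj : Function.Surjective (Fintype.linearCombination S g) := by
    rw [← LinearMap.range_eq_top, Fintype.range_linearCombination,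
      IsLocalRing.span_eq_top_of_tmul_eq_basis g b hb]
  have hker : LinearMap.ker (Fintype.linearCombination S g) = ⊥ := by
    have hq := ((Fintype.linearCombination S g).quotKerEquivOfSurjective hsurj).finrank_eq
    have hr := (LinearMap.ker (Fintype.linearCombination S g)).rank_quotient_add_rank
    rw [← Module.finrank_eq_rank, hq, hn, rank_fun', Fintype.card_fin] at hr
    rw [← Submodule.rank_eq_zero]
    exact Cardinal.eq_of_add_eq_add_left (hr.trans (add_zero _).symm) (Cardinal.natCast_lt_aleph0)
  exact Module.Free.of_equiv (LinearEquiv.ofBijective (Fintype.linearCombination S g)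
    ⟨LinearMap.ker_eq_bot.mp hker, hsurj⟩)

/-- The fibre of a module at a prime as a base change of its stalk. -/
theorem finrank_fiber_eq_finrank_residueField {R N : Type*} [CommRing R]
    [AddCommGroup N] [Module R N] (p : Ideal R) [p.IsPrime] :
    Module.finrank p.ResidueField (p.Fiber N) =
      Module.finrank (IsLocalRing.ResidueField (Localization.AtPrime p))
        (IsLocalRing.ResidueField (Localization.AtPrime p) ⊗[Localization.AtPrime p]
          LocalizedModule p.primeCompl N) := by
  let e : p.ResidueField ⊗[Localization.AtPrime p] (LocalizedModule p.primeCompl N)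
      ≃ₗ[p.ResidueField] p.Fiber N :=
    (AlgebraTensorModule.congr (LinearEquiv.refl _ _)
      (LocalizedModule.equivTensorProduct p.primeCompl N)) ≪≫ₗ
    AlgebraTensorModule.cancelBaseChange _ _ _ _ _
  exact e.finrank_eq.symm

theorem finrank_localizedModule_primeCompl {R N : Type*} [CommRing R] [IsDomain R]
    [AddCommGroup N] [Module R N] (p : Ideal R) [p.IsPrime] :
    Module.finrank (Localization.AtPrime p) (LocalizedModule p.primeCompl N) =
      Module.finrank R N := by
  rw [IsLocalization.finrank_eq (Localization.AtPrime p) p.primeCompl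
      p.primeCompl_le_nonZeroDivisors,
    IsLocalizedModule.finrank_eq p.primeCompl (LocalizedModule.mkLinearMap p.primeCompl N)
    p.primeCompl_le_nonZeroDivisors]

/-- Over a Jacobson domain, some maximal ideal lies in the free locus, so the fibre there has the
generic rank. -/
theorem exists_isMaximal_finrank_fiber_eq {R N : Type*} [CommRing R] [IsDomain R]
    [IsJacobsonRing R] [AddCommGroup N] [Module R N] [Module.FinitePresentation R N] :
    ∃ (m : Ideal R) (_ : m.IsMaximal),
      Module.finrank m.ResidueField (m.Fiber N) = Module.finrank R N := by
  have hbot : (⊥ : PrimeSpectrum R) ∈ Module.freeLocus R N := by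
    have : IsFractionRing R (Localization.AtPrime (⊥ : PrimeSpectrum R).asIdeal) := by
      have h : (⊥ : PrimeSpectrum R).asIdeal.primeCompl = nonZeroDivisors R := Ideal.primeCompl_bot
      rw [IsFractionRing, ← h]
      infer_instance
    let := IsFractionRing.toField R (K := (Localization.AtPrime (⊥ : PrimeSpectrum R).asIdeal))
    rw [Module.mem_freeLocus]
    exact Module.Free.of_divisionRing (Localization.AtPrime (⊥ : PrimeSpectrum R).asIdeal) _
  obtain ⟨_, ⟨f, rfl⟩, hf, hsub⟩ :=
    PrimeSpectrum.isTopologicalBasis_basic_opens.exists_subset_of_mem_open hbot Module.isOpen_freeLocus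
  have hf0 : f ≠ 0 := fun h => hf (by simp [h])
  obtain ⟨m, hm, hfm⟩ : ∃ m : Ideal R, m.IsMaximal ∧ f ∉ m := by
    by_contra! H
    have hf' : f ∈ Ideal.jacobson (⊥ : Ideal R) := Ideal.mem_sInf.mpr fun _ hI => H _ hI.2
    rw [IsJacobsonRing.out inferInstance Ideal.isPrime_bot.isRadical] at hf'
    exact hf0 hf'
  have := hm.isPrime
  refine ⟨m, hm, ?_⟩
  have hfree : Module.Free (Localization.AtPrime m) (LocalizedModule m.primeCompl N) :=
    hsub (show (⟨m, hm.isPrime⟩ : PrimeSpectrum R) ∈ _ from hfm)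
  rw [finrank_fiber_eq_finrank_residueField, Module.finrank_baseChange,
    finrank_localizedModule_primeCompl]

/-- Over a Jacobson domain, a finitely presented module whose fibres at maximal ideals have constant
dimension is projective of that rank. -/
theorem projective_of_finrank_fiber_eq {R N : Type*} [CommRing R] [IsDomain R]
    [IsJacobsonRing R] [AddCommGroup N] [Module R N] [Module.FinitePresentation R N] {d : ℕ}
    (h : ∀ (m : Ideal R) [m.IsMaximal], Module.finrank m.ResidueField (m.Fiber N) = d) :
    Module.Projective R N ∧ Module.finrank R N = d := by
  obtain ⟨m₀, hm₀, h₀⟩ := exists_isMaximal_finrank_fiber_eq (R := R) (N := N)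
  have hd : Module.finrank R N = d := by rw [← h₀, h m₀]
  refine ⟨Module.projective_of_localization_maximal fun m hm => ?_, hd⟩
  have := free_of_finrank_residueField_eq (S := Localization.AtPrime m)
    (N := LocalizedModule m.primeCompl N) (by
      rw [← finrank_fiber_eq_finrank_residueField, h m, finrank_localizedModule_primeCompl, hd])
  infer_instance

/-- The kernel of a surjection between projective modules is projective. -/
theorem projective_ker_of_surjective {R P Q : Type*} [CommRing R] [AddCommGroup P] [Module R P]
    [AddCommGroup Q] [Module R Q] [Module.Projective R P] [Module.Projective R Q] (f : P →ₗ[R] Q)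
    (hf : LinearMap.range f = ⊤) : Module.Projective R (LinearMap.ker f) := by
  obtain ⟨s, hs⟩ := f.exists_rightInverse_of_surjective hf
  refine Module.Projective.of_split (LinearMap.ker f).subtype
    (LinearMap.codRestrict _ (LinearMap.id - s ∘ₗ f) fun x => ?_) ?_
  · simpa [sub_eq_zero] using (LinearMap.congr_fun hs (f x)).symm
  · ext x
    simp

theorem projective_range_of_projective_quotient {R F G : Type*} [CommRing R] [AddCommGroup F]
    [Module R F] [AddCommGroup G] [Module R G] [Module.Projective R G] (T : F →ₗ[R] G)
    [Module.Projective R (G ⧸ LinearMap.range T)] :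
    Module.Projective R (LinearMap.range T) := by
  have := projective_ker_of_surjective (LinearMap.range T).mkQ (Submodule.range_mkQ _)
  rwa [Submodule.ker_mkQ] at this

theorem projective_ker_of_projective_quotient {R F G : Type*} [CommRing R] [AddCommGroup F]
    [Module R F] [AddCommGroup G] [Module R G] [Module.Projective R F] [Module.Projective R G]
    (T : F →ₗ[R] G) [Module.Projective R (G ⧸ LinearMap.range T)] :
    Module.Projective R (LinearMap.ker T) := by
  have := projective_range_of_projective_quotient T
  have := projective_ker_of_surjective T.rangeRestrict (LinearMap.range_rangeRestrict T)
  rwa [LinearMap.ker_rangeRestrict] at this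

/-- The cokernel of a base change has the same dimension as the cokernel. -/
theorem finrank_tensor_quotient_range_eq {k σ : Type*} [Field k] {V W κ : Type*}
    [AddCommGroup V] [Module k V] [AddCommGroup W] [Module k W] [Field κ] [Algebra k κ]
    [Algebra (MvPolynomial σ k) κ] [IsScalarTower k (MvPolynomial σ k) κ] (y : σ → k)
    (hy : ∀ f : MvPolynomial σ k,
      algebraMap (MvPolynomial σ k) κ f = algebraMap k κ (MvPolynomial.aeval y f))
    (T : MvPolynomial σ k ⊗[k] V →ₗ[MvPolynomial σ k] MvPolynomial σ k ⊗[k] W) (t : V →ₗ[k] W)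
    (hT : ∀ v, TensorProduct.lid k W ((MvPolynomial.aeval y).toLinearMap.rTensor W (T (1 ⊗ₜ v))) =
      t v) :
    Module.finrank κ (κ ⊗[MvPolynomial σ k] ((MvPolynomial σ k ⊗[k] W) ⧸ LinearMap.range T)) =
      Module.finrank k (W ⧸ LinearMap.range t) := by
  let eV := AlgebraTensorModule.cancelBaseChange k (MvPolynomial σ k) κ κ V
  let eW := AlgebraTensorModule.cancelBaseChange k (MvPolynomial σ k) κ κ W
  have heW (z : MvPolynomial σ k ⊗[k] W) : eW (1 ⊗ₜ z) =
      1 ⊗ₜ TensorProduct.lid k W ((MvPolynomial.aeval y).toLinearMap.rTensor W z) := by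
    induction z with
    | zero => simp
    | add a b ha hb => simp only [tmul_add, map_add, ha, hb]
    | tmul f w =>
      simp [eW, Algebra.smul_def, hy]
      rw [Algebra.algebraMap_eq_smul_one, smul_tmul']
  have hcomm : eW.toLinearMap ∘ₗ T.baseChange κ = t.baseChange κ ∘ₗ eV.toLinearMap := by
    suffices h : (eW.toLinearMap ∘ₗ T.baseChange κ) ∘ₗ eV.symm.toLinearMap = t.baseChange κ by
      rw [← h, LinearMap.comp_assoc]; simp
    ext v
    simp [eV, heW, hT]
  have hmap : (LinearMap.range (T.baseChange κ)).map eW.toLinearMap =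
      LinearMap.range (t.baseChange κ) := by
    rw [← LinearMap.range_comp, hcomm, LinearMap.range_comp, LinearEquiv.range, Submodule.map_top]
  have hexT : Function.Exact (T.baseChange κ) ((LinearMap.range T).mkQ.baseChange κ) :=
    lTensor_exact κ (LinearMap.exact_map_mkQ_range T) (Submodule.mkQ_surjective _)
  have hext : Function.Exact (t.baseChange κ) ((LinearMap.range t).mkQ.baseChange κ) :=
    lTensor_exact κ (LinearMap.exact_map_mkQ_range t) (Submodule.mkQ_surjective _)
  have eT := ((Submodule.quotEquivOfEq _ _ hexT.linearMap_ker_eq.symm).trans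
    (LinearMap.quotKerEquivOfSurjective _ (LinearMap.lTensor_surjective κ
      (Submodule.mkQ_surjective (LinearMap.range T))))).finrank_eq
  have et := ((Submodule.quotEquivOfEq _ _ hext.linearMap_ker_eq.symm).trans
    (LinearMap.quotKerEquivOfSurjective _ (LinearMap.lTensor_surjective κ
      (Submodule.mkQ_surjective (LinearMap.range t))))).finrank_eq
  rw [← eT, (Submodule.Quotient.equiv _ _ eW hmap).finrank_eq, et, Module.finrank_baseChange]

/-- If the specializations of `T` at all `k`-points have constant rank `e`, then `T` has projective
cokernel and image of rank `e`. -/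
theorem projective_quotient_range_of_finrank_range_eq {k σ : Type*} [Field k] [IsAlgClosed k]
    [Finite σ] {V W : Type*} [AddCommGroup V] [Module k V] [FiniteDimensional k V]
    [AddCommGroup W] [Module k W] [FiniteDimensional k W]
    (T : MvPolynomial σ k ⊗[k] V →ₗ[MvPolynomial σ k] MvPolynomial σ k ⊗[k] W)
    (t : (σ → k) → V →ₗ[k] W)
    (hT : ∀ y v, TensorProduct.lid k W
      ((MvPolynomial.aeval y).toLinearMap.rTensor W (T (1 ⊗ₜ v))) = t y v) {e : ℕ}
    (he : ∀ y, Module.finrank k (LinearMap.range (t y)) = e) :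
    Module.Projective (MvPolynomial σ k) ((MvPolynomial σ k ⊗[k] W) ⧸ LinearMap.range T) ∧
      Module.finrank (MvPolynomial σ k) (LinearMap.range T) = e := by
  have hfp : Module.FinitePresentation (MvPolynomial σ k)
      ((MvPolynomial σ k ⊗[k] W) ⧸ LinearMap.range T) :=
    Module.finitePresentation_of_finite _ _
  have hle : e ≤ Module.finrank k W := he 0 ▸ Submodule.finrank_le _
  obtain ⟨hp, hr⟩ := projective_of_finrank_fiber_eq (R := MvPolynomial σ k)
      (N := (MvPolynomial σ k ⊗[k] W) ⧸ LinearMap.range T) (d := Module.finrank k W - e) (by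
    intro m hm
    obtain ⟨y, rfl⟩ := MvPolynomial.isMaximal_iff_eq_vanishingIdeal_singleton.mp hm
    rw [finrank_tensor_quotient_range_eq y _ T (t y) (hT y)]
    · have := (LinearMap.range (t y)).finrank_quotient_add_finrank
      have := he y
      omega
    · intro f
      rw [IsScalarTower.algebraMap_apply k (MvPolynomial σ k), ← sub_eq_zero, ← map_sub,
        Ideal.algebraMap_residueField_eq_zero, MvPolynomial.mem_vanishingIdeal_singleton_iff]
      simp)
  refine ⟨hp, ?_⟩
  have := (LinearMap.range T).finrank_quotient_add_finrank
  rw [hr, Module.finrank_baseChange] at this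
  omega

theorem socPow_span_range_one {k A M ι : Type*} [Field k] [CommRing A] [Algebra k A]
    [AddCommGroup M] [Module k M] [Module A M] [IsScalarTower k A M] (u : ι → A) :
    socPow k A M (Submodule.span k (Set.range u) : Set A) 1 =
      ⨅ j, LinearMap.ker (smulLinear k M (u j)) := by
  ext m
  simp only [socPow, Submodule.mem_iInf, LinearMap.mem_ker]
  constructor
  · intro h j
    simpa using h (fun _ => u j) fun _ => Submodule.subset_span ⟨j, rfl⟩
  · intro h v hv
    have key : ∀ a ∈ Submodule.span k (Set.range u), a • m = 0 := by
      intro a ha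
      induction ha using Submodule.span_induction with
      | mem x hx => obtain ⟨j, rfl⟩ := hx; exact h j
      | zero => exact zero_smul A m
      | add x y _ _ hx hy => rw [add_smul, hx, hy, add_zero]
      | smul c x _ hx => rw [smul_assoc, hx, smul_zero]
    simpa [smulLinear] using key _ (hv 0)

theorem radPow_span_range_one {k A M ι : Type*} [Field k] [CommRing A] [Algebra k A]
    [AddCommGroup M] [Module k M] [Module A M] [IsScalarTower k A M] (u : ι → A) :
    radPow k A M (Submodule.span k (Set.range u) : Set A) 1 =
      ⨆ j, LinearMap.range (smulLinear k M (u j)) := by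
  apply le_antisymm
  · refine iSup₂_le fun v hv => ?_
    rintro _ ⟨m, rfl⟩
    have key : ∀ a ∈ Submodule.span k (Set.range u),
        a • m ∈ ⨆ j, LinearMap.range (smulLinear k M (u j)) := by
      intro a ha
      induction ha using Submodule.span_induction with
      | mem x hx =>
        obtain ⟨j, rfl⟩ := hx
        exact Submodule.mem_iSup_of_mem j ⟨m, rfl⟩
      | zero => rw [zero_smul]; exact zero_mem _
      | add x y _ _ hx hy => rw [add_smul]; exact add_mem hx hy
      | smul c x _ hx => rw [smul_assoc]; exact Submodule.smul_mem _ _ hx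
    simpa [smulLinear] using key _ (hv 0)
  · refine iSup_le fun j => ?_
    refine le_trans (le_of_eq ?_) (le_iSup₂_of_le (fun _ : Fin 1 => u j)
      (fun _ => Submodule.subset_span ⟨j, rfl⟩) le_rfl)
    simp

/-- The linear parts of the elements of the truncated polynomial algebra. -/
def truncLinearPart (k : Type*) [Field k] (n p : ℕ) (hp : 2 ≤ p) :
    TruncAlg k n p →ₐ[k] TrivSqZeroExt k (Fin n → k) :=
  Ideal.Quotient.liftₐ (truncIdeal k n p)
    (MvPolynomial.aeval fun i => TrivSqZeroExt.inr (Pi.single i 1)) fun a ha => by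
      rw [← RingHom.mem_ker]
      refine (Ideal.span_le.mpr ?_ : truncIdeal k n p ≤ _) ha
      rintro _ ⟨i, rfl⟩
      obtain ⟨q, rfl⟩ := Nat.exists_eq_add_of_le hp
      simp [pow_add, pow_two]

/-- The basis `x_j + ∑ i, y_{ij} x_i` of the `r`-plane with affine coordinates `y`. -/
def chartVec (k : Type*) [Field k] (p n r : ℕ) (hrn : r ≤ n) (y : Fin (n - r) × Fin r → k)
    (j : Fin r) : TruncAlg k n p :=
  xGen k n p (Fin.castLE hrn j) +
    ∑ i : Fin (n - r), y (i, j) • xGen k n p ⟨r + i.val, by have := i.isLt; omega⟩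

theorem linearIndependent_chartVec {k : Type*} [Field k] {p n r : ℕ} (hp : 2 ≤ p) (hrn : r ≤ n)
    (y : Fin (n - r) × Fin r → k) : LinearIndependent k (chartVec k p n r hrn y) := by
  let φ : TruncAlg k n p →ₗ[k] Fin r → k :=
    LinearMap.funLeft k k (Fin.castLE hrn) ∘ₗ TrivSqZeroExt.sndHom k (Fin n → k) ∘ₗ
      (truncLinearPart k n p hp).toLinearMap
  have hx (i : Fin n) : (truncLinearPart k n p hp) (xGen k n p i) =
      TrivSqZeroExt.inr (Pi.single i 1) := by
    exact (Ideal.Quotient.liftₐ_apply _ _ _ _).trans (MvPolynomial.aeval_X _ i)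
  have hφ (i : Fin n) (l : Fin r) :
      φ (xGen k n p i) l = (Pi.single i 1 : Fin n → k) (Fin.castLE hrn l) := by
    simp [φ, hx, LinearMap.funLeft_apply]
  refine LinearIndependent.of_comp φ ?_
  have : φ ∘ chartVec k p n r hrn y = Pi.basisFun k (Fin r) := by
    ext j l
    have hne (i : Fin (n - r)) : (l : ℕ) ≠ r + i := by omega
    simp [chartVec, hφ, Pi.single_apply, Fin.ext_iff, hne]
  rw [this]
  exact (Pi.basisFun k (Fin r)).linearIndependent

theorem span_chartVec_le_xSpan {k : Type*} [Field k] {p n r : ℕ} (hrn : r ≤ n)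
    (y : Fin (n - r) × Fin r → k) :
    Submodule.span k (Set.range (chartVec k p n r hrn y)) ≤ xSpan k n p := by
  rw [Submodule.span_le]
  rintro _ ⟨j, rfl⟩
  exact add_mem (Submodule.subset_span ⟨_, rfl⟩)
    (sum_mem fun i _ => Submodule.smul_mem _ _ (Submodule.subset_span ⟨_, rfl⟩))

theorem aeval_thetaOp {k : Type*} [Field k] {p n r : ℕ} (hrn : r ≤ n)
    {M : Type*} [AddCommGroup M] [Module k M] [Module (TruncAlg k n p) M]
    [IsScalarTower k (TruncAlg k n p) M] (y : Fin (n - r) × Fin r → k) (j : Fin r) (m : M) :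
    TensorProduct.lid k M ((MvPolynomial.aeval y).toLinearMap.rTensor M
      (thetaOp k p n r hrn M j (1 ⊗ₜ m))) = chartVec k p n r hrn y j • m := by
  simp [thetaOp, chartVec, smulLinear, add_smul, Finset.sum_smul, smul_tmul']

/-- A finite projective module over a domain has free stalks of rank its generic rank. -/
theorem free_localizedModule_and_rankAtStalk {R N : Type*} [CommRing R] [IsDomain R]
    [AddCommGroup N] [Module R N] [Module.Finite R N] [Module.Projective R N] (m : Ideal R)
    [m.IsPrime] :
    Module.Free (Localization.AtPrime m) (LocalizedModule m.primeCompl N) ∧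
      Module.rankAtStalk (R := R) N ⟨m, inferInstance⟩ = Module.finrank R N :=
  ⟨Module.free_of_flat_of_isLocalRing, finrank_localizedModule_primeCompl m⟩

theorem lid_rTensor_aeval_baseChange {k σ V W : Type*} [Field k] [AddCommGroup V] [Module k V]
    [AddCommGroup W] [Module k W] (y : σ → k) (g : V →ₗ[k] W) (z : MvPolynomial σ k ⊗[k] V) :
    TensorProduct.lid k W ((MvPolynomial.aeval y).toLinearMap.rTensor W
      (g.baseChange (MvPolynomial σ k) z)) =
    g (TensorProduct.lid k V ((MvPolynomial.aeval y).toLinearMap.rTensor V z)) := by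
  induction z with
  | zero => simp
  | add a b ha hb => simp only [map_add, ha, hb]
  | tmul f v => simp

theorem baseChange_proj_single {k R ι M : Type*} [CommRing k] [CommRing R] [Algebra k R]
    [DecidableEq ι] [AddCommGroup M] [Module k M] (i j : ι) (z : R ⊗[k] M) :
    (LinearMap.proj i : (ι → M) →ₗ[k] M).baseChange R
      ((LinearMap.single k (fun _ : ι => M) j).baseChange R z) = if i = j then z else 0 := by
  rw [← LinearMap.comp_apply, ← LinearMap.baseChange_comp]
  split_ifs with h
  · subst h
    rw [LinearMap.proj_comp_single_same, LinearMap.baseChange_id, LinearMap.id_apply]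
  · rw [LinearMap.proj_comp_single_ne _ _ _ _ h, LinearMap.baseChange_zero,
      LinearMap.zero_apply]

theorem projective_and_finrank_iInf_ker_thetaOp {k : Type*} [Field k] [IsAlgClosed k]
    {p n r : ℕ} (hp : 2 ≤ p) (hrn : r ≤ n) {M : Type*} [AddCommGroup M] [Module k M] [Module (TruncAlg k n p) M]
    [IsScalarTower k (TruncAlg k n p) M] [FiniteDimensional k M] {c : ℕ}
    (hc : ∀ U : Submodule k (TruncAlg k n p), U ≤ xSpan k n p → Module.finrank k U = r →
      Module.finrank k (socPow k (TruncAlg k n p) M (U : Set (TruncAlg k n p)) 1) = c) :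
    Module.Projective (MvPolynomial (Fin (n - r) × Fin r) k)
        ↥(⨅ j : Fin r, LinearMap.ker (thetaOp k p n r hrn M j)) ∧
      Module.finrank (MvPolynomial (Fin (n - r) × Fin r) k)
        ↥(⨅ j : Fin r, LinearMap.ker (thetaOp k p n r hrn M j)) = c := by
  let T : MvPolynomial (Fin (n - r) × Fin r) k ⊗[k] M →ₗ[MvPolynomial (Fin (n - r) × Fin r) k]
      MvPolynomial (Fin (n - r) × Fin r) k ⊗[k] (Fin r → M) :=
    ∑ j, (LinearMap.single k (fun _ : Fin r => M) j).baseChange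
      (MvPolynomial (Fin (n - r) × Fin r) k) ∘ₗ thetaOp k p n r hrn M j
  let t (y : Fin (n - r) × Fin r → k) : M →ₗ[k] Fin r → M :=
    LinearMap.pi fun j => smulLinear k M (chartVec k p n r hrn y j)
  have hT (y v) : TensorProduct.lid k _
      ((MvPolynomial.aeval y).toLinearMap.rTensor _ (T (1 ⊗ₜ v))) = t y v := by
    simp only [T, LinearMap.sum_apply, LinearMap.comp_apply, map_sum,
      lid_rTensor_aeval_baseChange, aeval_thetaOp]
    exact LinearMap.sum_single_apply (fun _ : Fin r => M) (t y v)
  have hker : LinearMap.ker T = ⨅ j : Fin r, LinearMap.ker (thetaOp k p n r hrn M j) := by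
    ext z
    simp only [Submodule.mem_iInf, LinearMap.mem_ker]
    constructor
    · intro hz j
      have := congrArg ((LinearMap.proj j : (Fin r → M) →ₗ[k] M).baseChange
        (MvPolynomial (Fin (n - r) × Fin r) k)) hz
      rw [map_zero] at this
      rw [← this]
      simp [T, baseChange_proj_single]
    · intro hz
      simp [T, hz]
  have hkt (y) : Module.finrank k (LinearMap.ker (t y)) = c := by
    rw [LinearMap.ker_pi, ← socPow_span_range_one]
    refine hc _ (span_chartVec_le_xSpan hrn y) ?_
    rw [finrank_span_eq_card (linearIndependent_chartVec hp hrn y), Fintype.card_fin]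
  obtain ⟨hproj, hrank⟩ := projective_quotient_range_of_finrank_range_eq T t hT
    (e := Module.finrank k M - c) fun y => by
      have := (t y).finrank_range_add_finrank_ker
      have := hkt y
      omega
  rw [← hker]
  refine ⟨projective_ker_of_projective_quotient T, ?_⟩
  have h1 := (LinearMap.ker T).finrank_quotient_add_finrank
  rw [T.quotKerEquivRange.finrank_eq, hrank, Module.finrank_baseChange] at h1
  have h2 := (LinearMap.ker (t 0)).finrank_le
  rw [hkt 0] at h2
  omega

theorem projective_and_finrank_iSup_range_thetaOp {k : Type*} [Field k] [IsAlgClosed k]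
    {p n r : ℕ} (hp : 2 ≤ p) (hrn : r ≤ n) {M : Type*} [AddCommGroup M] [Module k M] [Module (TruncAlg k n p) M]
    [IsScalarTower k (TruncAlg k n p) M] [FiniteDimensional k M] {c : ℕ}
    (hc : ∀ U : Submodule k (TruncAlg k n p), U ≤ xSpan k n p → Module.finrank k U = r →
      Module.finrank k (radPow k (TruncAlg k n p) M (U : Set (TruncAlg k n p)) 1) = c) :
    Module.Projective (MvPolynomial (Fin (n - r) × Fin r) k)
        ↥(⨆ j : Fin r, LinearMap.range (thetaOp k p n r hrn M j)) ∧
      Module.finrank (MvPolynomial (Fin (n - r) × Fin r) k)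
        ↥(⨆ j : Fin r, LinearMap.range (thetaOp k p n r hrn M j)) = c := by
  let T : MvPolynomial (Fin (n - r) × Fin r) k ⊗[k] (Fin r → M)
      →ₗ[MvPolynomial (Fin (n - r) × Fin r) k] MvPolynomial (Fin (n - r) × Fin r) k ⊗[k] M :=
    ∑ j, thetaOp k p n r hrn M j ∘ₗ
      (LinearMap.proj j : (Fin r → M) →ₗ[k] M).baseChange (MvPolynomial (Fin (n - r) × Fin r) k)
  let t (y : Fin (n - r) × Fin r → k) : (Fin r → M) →ₗ[k] M :=
    ∑ j, smulLinear k M (chartVec k p n r hrn y j) ∘ₗ LinearMap.proj j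
  have hT (y v) : TensorProduct.lid k _
      ((MvPolynomial.aeval y).toLinearMap.rTensor _ (T (1 ⊗ₜ v))) = t y v := by
    simp only [T, t, LinearMap.sum_apply, LinearMap.comp_apply, map_sum,
      LinearMap.baseChange_tmul, aeval_thetaOp]
    rfl
  have hTs (j : Fin r) : T ∘ₗ (LinearMap.single k (fun _ : Fin r => M) j).baseChange
      (MvPolynomial (Fin (n - r) × Fin r) k) =
      thetaOp k p n r hrn M j := by
    refine LinearMap.ext fun z => ?_
    simp [T, baseChange_proj_single, apply_ite]
  have hrange : LinearMap.range T = ⨆ j : Fin r, LinearMap.range (thetaOp k p n r hrn M j) := by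
    apply le_antisymm
    · rintro _ ⟨z, rfl⟩
      simp only [T, LinearMap.sum_apply, LinearMap.comp_apply]
      exact sum_mem fun j _ => Submodule.mem_iSup_of_mem j ⟨_, rfl⟩
    · exact iSup_le fun j => hTs j ▸ LinearMap.range_comp_le_range _ _
  have hts (y) (j : Fin r) : t y ∘ₗ LinearMap.single k (fun _ : Fin r => M) j =
      smulLinear k M (chartVec k p n r hrn y j) := by
    refine LinearMap.ext fun z => ?_
    simp [t, Pi.single_apply, apply_ite]
  have hrt (y) : LinearMap.range (t y) =
      ⨆ j, LinearMap.range (smulLinear k M (chartVec k p n r hrn y j)) := by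
    apply le_antisymm
    · rintro _ ⟨z, rfl⟩
      simp only [t, LinearMap.sum_apply, LinearMap.comp_apply]
      exact sum_mem fun j _ => Submodule.mem_iSup_of_mem j ⟨_, rfl⟩
    · exact iSup_le fun j => hts y j ▸ LinearMap.range_comp_le_range _ _
  obtain ⟨hproj, hrank⟩ := projective_quotient_range_of_finrank_range_eq T t hT (e := c) fun y => by
    rw [hrt, ← radPow_span_range_one]
    refine hc _ (span_chartVec_le_xSpan hrn y) ?_
    rw [finrank_span_eq_card (linearIndependent_chartVec hp hrn y), Fintype.card_fin]
  rw [← hrange]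
  exact ⟨projective_range_of_projective_quotient T, hrank⟩

/-- Kernel and image bundles are locally free of constant rank: if `M` has constant
`r`-`Soc` rank `c` (resp. constant `r`-`Rad` rank `c′`), then `⋂_j ker θ_j`
(resp. `Σ_j im θ_j`) is a finitely generated projective `R`-module whose localization at
every maximal ideal `𝔪` of `R` is a free `R_𝔪`-module of rank `c` (resp. `c′`). -/
theorem statement18 {k : Type*} [Field k] [IsAlgClosed k] (p n r : ℕ) [Fact p.Prime]
    [CharP k p] (hr : 1 ≤ r) (hrn : r ≤ n)
    (M : Type*) [AddCommGroup M] [Module k M] [Module (TruncAlg k n p) M]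
    [IsScalarTower k (TruncAlg k n p) M] [FiniteDimensional k M] :
    (∀ c : ℕ,
      (∀ U : Submodule k (TruncAlg k n p), U ≤ xSpan k n p → Module.finrank k U = r →
        Module.finrank k
          ↥(socPow k (TruncAlg k n p) M (U : Set (TruncAlg k n p)) 1) = c) →
      Module.Finite (MvPolynomial (Fin (n - r) × Fin r) k)
          ↥(⨅ j : Fin r, LinearMap.ker (thetaOp k p n r hrn M j)) ∧
      Module.Projective (MvPolynomial (Fin (n - r) × Fin r) k)
          ↥(⨅ j : Fin r, LinearMap.ker (thetaOp k p n r hrn M j)) ∧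
      ∀ (𝔪 : Ideal (MvPolynomial (Fin (n - r) × Fin r) k)) (hm : 𝔪.IsMaximal),
        (letI : 𝔪.IsPrime := hm.isPrime
         Module.Free (Localization.AtPrime 𝔪)
          (LocalizedModule 𝔪.primeCompl
            ↥(⨅ j : Fin r, LinearMap.ker (thetaOp k p n r hrn M j)))) ∧
        Module.rankAtStalk (R := MvPolynomial (Fin (n - r) × Fin r) k)
          ↥(⨅ j : Fin r, LinearMap.ker (thetaOp k p n r hrn M j)) ⟨𝔪, hm.isPrime⟩ = c) ∧
    (∀ c' : ℕ,
      (∀ U : Submodule k (TruncAlg k n p), U ≤ xSpan k n p → Module.finrank k U = r →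
        Module.finrank k
          ↥(radPow k (TruncAlg k n p) M (U : Set (TruncAlg k n p)) 1) = c') →
      Module.Finite (MvPolynomial (Fin (n - r) × Fin r) k)
          ↥(⨆ j : Fin r, LinearMap.range (thetaOp k p n r hrn M j)) ∧
      Module.Projective (MvPolynomial (Fin (n - r) × Fin r) k)
          ↥(⨆ j : Fin r, LinearMap.range (thetaOp k p n r hrn M j)) ∧
      ∀ (𝔪 : Ideal (MvPolynomial (Fin (n - r) × Fin r) k)) (hm : 𝔪.IsMaximal),
        (letI : 𝔪.IsPrime := hm.isPrime
         Module.Free (Localization.AtPrime 𝔪)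
          (LocalizedModule 𝔪.primeCompl
            ↥(⨆ j : Fin r, LinearMap.range (thetaOp k p n r hrn M j)))) ∧
        Module.rankAtStalk (R := MvPolynomial (Fin (n - r) × Fin r) k)
          ↥(⨆ j : Fin r, LinearMap.range (thetaOp k p n r hrn M j)) ⟨𝔪, hm.isPrime⟩ = c') := by
  have hp : 2 ≤ p := (Fact.out : p.Prime).two_le
  refine ⟨fun c hc => ?_, fun c hc => ?_⟩
  · obtain ⟨hproj, hrank⟩ := projective_and_finrank_iInf_ker_thetaOp hp hrn hc
    have hfin : Module.Finite (MvPolynomial (Fin (n - r) × Fin r) k)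
        ↥(⨅ j : Fin r, LinearMap.ker (thetaOp k p n r hrn M j)) := inferInstance
    refine ⟨hfin, hproj, fun 𝔪 hm => ?_⟩
    have := hm.isPrime
    rw [← hrank]
    exact free_localizedModule_and_rankAtStalk
      (N := ↥(⨅ j : Fin r, LinearMap.ker (thetaOp k p n r hrn M j))) 𝔪
  · obtain ⟨hproj, hrank⟩ := projective_and_finrank_iSup_range_thetaOp hp hrn hc
    have hfin : Module.Finite (MvPolynomial (Fin (n - r) × Fin r) k)
        ↥(⨆ j : Fin r, LinearMap.range (thetaOp k p n r hrn M j)) := inferInstance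
    refine ⟨hfin, hproj, fun 𝔪 hm => ?_⟩
    have := hm.isPrime
    rw [← hrank]
    exact free_localizedModule_and_rankAtStalk
      (N := ↥(⨆ j : Fin r, LinearMap.range (thetaOp k p n r hrn M j))) 𝔪

end
end
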